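/- arXiv:2004.14263 — 12 statements merged into one kernel-verified Lean document; each statement's English description precedes it below -/
import Mathlib

section
/- Let V be a finite-dimensional complex inner product space and let P, Q : V → V be orthogonal projections (self-adjoint idempotent linear maps). Then V decomposes as an internal orthogonal direct sum of subspaces W₁, …, W_r, each of dimension at most 2, such that every W_s is invariant under both P and Q; moreover, on each two-dimensional summand W_s on which neither restriction is 0 or the identity, the restrictions of P and of Q to W_s are rank-one orthogonal projections. -/
open Module

lemma aux_vec {V : Type*} [NormedAddCommGroup V] [InnerProductSpace ℂ V]
    [FiniteDimensional ℂ V] (P Q : V →ₗ[ℂ] V)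
    (hP : ∀ x, P (P x) = P x) (hQ : ∀ x, Q (Q x) = Q x)
    (U : Submodule ℂ V) (hU : U ≠ ⊥) (hPU : ∀ x ∈ U, P x ∈ U) (hQU : ∀ x ∈ U, Q x ∈ U) :
    ∃ v ∈ U, v ≠ 0 ∧ (∃ e : ℂ, P v = e • v) ∧
      ∃ c : ℂ, P v + Q v - P (Q v) - Q (P v) = c • v := by
  let A : V →ₗ[ℂ] V := P + Q - P ∘ₗ Q - Q ∘ₗ P
  have hAU : ∀ x ∈ U, A x ∈ U := fun x hx =>
    U.sub_mem (U.sub_mem (U.add_mem (hPU x hx) (hQU x hx)) (hPU _ (hQU x hx))) (hQU _ (hPU x hx))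
  haveI : Nontrivial U := Submodule.nontrivial_iff_ne_bot.mpr hU
  obtain ⟨c, hc⟩ := Module.End.exists_eigenvalue (A.restrict hAU)
  obtain ⟨v, hv⟩ := hc.exists_hasEigenvector
  have h1 : P v + Q v - P (Q v) - Q (P v) = c • (v : V) := by
    have := congrArg Subtype.val hv.apply_eq_smul
    simpa [A] using this
  have hv0 : (v : V) ≠ 0 := by simpa using hv.2
  by_cases hPv : P (v : V) = 0
  · exact ⟨v, v.2, hv0, ⟨0, by simp [hPv]⟩, c, h1⟩
  · refine ⟨P v, hPU _ v.2, hPv, ⟨1, by simp [hP]⟩, c, ?_⟩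
    have h2 := congrArg P h1
    simp only [map_sub, map_add, map_smul, hP] at h2
    rw [← h2, hP]
    abel

lemma aux_sub {V : Type*} [NormedAddCommGroup V] [InnerProductSpace ℂ V]
    [FiniteDimensional ℂ V] (P Q : V →ₗ[ℂ] V)
    (hP : ∀ x, P (P x) = P x) (hQ : ∀ x, Q (Q x) = Q x)
    (U : Submodule ℂ V) (hU : U ≠ ⊥) (hPU : ∀ x ∈ U, P x ∈ U) (hQU : ∀ x ∈ U, Q x ∈ U) :
    ∃ W ≤ U, W ≠ ⊥ ∧ finrank ℂ W ≤ 2 ∧ (∀ x ∈ W, P x ∈ W) ∧ (∀ x ∈ W, Q x ∈ W) := by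
  obtain ⟨v, hvU, hv0, ⟨e, he⟩, c, hc⟩ := aux_vec P Q hP hQ U hU hPU hQU
  have hvm : v ∈ Submodule.span ℂ {v, Q v} := Submodule.subset_span (by simp)
  have hqm : Q v ∈ Submodule.span ℂ {v, Q v} := Submodule.subset_span (by simp)
  have hPQ : P (Q v) = e • v + Q v - e • Q v - c • v := by
    rw [← hc, he, map_smul]; abel
  refine ⟨Submodule.span ℂ {v, Q v}, ?_, ?_, ?_, ?_, ?_⟩
  · rw [Submodule.span_le]
    rintro x (rfl | rfl)
    · exact hvU
    · exact hQU _ hvU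
  · intro h
    rw [h] at hvm
    exact hv0 (by simpa using hvm)
  · classical
    have := finrank_span_finset_le_card (R := ℂ) ({v, Q v} : Finset V)
    have h2 := Finset.card_le_two (a := v) (b := Q v)
    have h3 : (({v, Q v} : Finset V) : Set V) = {v, Q v} := by simp
    have h4 := this.trans h2
    rw [h3] at h4
    exact h4
  · intro x hx
    obtain ⟨a, b, rfl⟩ := Submodule.mem_span_pair.mp hx
    rw [map_add, map_smul, map_smul, he, hPQ]
    refine Submodule.mem_span_pair.mpr ⟨a * e + b * e - b * c, b - b * e, ?_⟩
    module
  · intro x hx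
    obtain ⟨a, b, rfl⟩ := Submodule.mem_span_pair.mp hx
    rw [map_add, map_smul, map_smul, hQ]
    exact Submodule.mem_span_pair.mpr ⟨0, a + b, by module⟩

lemma aux_orth {V : Type*} [NormedAddCommGroup V] [InnerProductSpace ℂ V]
    (P : V →ₗ[ℂ] V) (hP : P.IsSymmetric) (W : Submodule ℂ V) (h : ∀ x ∈ W, P x ∈ W) :
    ∀ x ∈ Wᗮ, P x ∈ Wᗮ := by
  intro x hx
  rw [Submodule.mem_orthogonal] at hx ⊢
  intro u hu
  rw [← hP u x]
  exact hx _ (h u hu)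

lemma aux_dec {V : Type*} [NormedAddCommGroup V] [InnerProductSpace ℂ V]
    [FiniteDimensional ℂ V] (P Q : V →ₗ[ℂ] V)
    (hP : ∀ x, P (P x) = P x) (hQ : ∀ x, Q (Q x) = Q x)
    (hPsa : P.IsSymmetric) (hQsa : Q.IsSymmetric) (n : ℕ) :
    ∀ (U : Submodule ℂ V), finrank ℂ U ≤ n →
      (∀ x ∈ U, P x ∈ U) → (∀ x ∈ U, Q x ∈ U) →
    ∃ (r : ℕ) (W : Fin r → Submodule ℂ V),
      (∀ i j, i ≠ j → W i ≤ (W j)ᗮ) ∧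
      (⨆ i, W i) = U ∧
      (∀ i, finrank ℂ (W i) ≤ 2) ∧
      (∀ i, ∀ x ∈ W i, P x ∈ W i) ∧ (∀ i, ∀ x ∈ W i, Q x ∈ W i) := by
  induction n with
  | zero =>
    intro U hU _ _
    have : U = ⊥ := Submodule.finrank_eq_zero.mp (by omega)
    exact ⟨0, fun i => i.elim0, fun i => i.elim0, by simp [this], fun i => i.elim0,
      fun i => i.elim0, fun i => i.elim0⟩
  | succ n ih =>
    intro U hUn hPU hQU
    by_cases hU : U = ⊥
    · exact ⟨0, fun i => i.elim0, fun i => i.elim0, by simp [hU], fun i => i.elim0,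
        fun i => i.elim0, fun i => i.elim0⟩
    obtain ⟨W0, hWU, hW0, hd, hPW, hQW⟩ := aux_sub P Q hP hQ U hU hPU hQU
    have hsup : W0 ⊔ W0ᗮ ⊓ U = U := Submodule.sup_orthogonal_inf_of_hasOrthogonalProjection hWU
    have hlt : W0ᗮ ⊓ U < U := by
      refine lt_of_le_of_ne inf_le_right fun h => hW0 ?_
      have h1 : W0 ≤ W0ᗮ := hWU.trans (inf_eq_right.mp h)
      have h2 := W0.inf_orthogonal_eq_bot
      rwa [inf_eq_left.mpr h1] at h2
    have hfr := Submodule.finrank_lt_finrank_of_lt hlt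
    obtain ⟨r, W, h1, h2, h3, h4, h5⟩ := ih (W0ᗮ ⊓ U) (by omega)
      (fun x hx => ⟨aux_orth P hPsa W0 hPW x hx.1, hPU x hx.2⟩)
      (fun x hx => ⟨aux_orth Q hQsa W0 hQW x hx.1, hQU x hx.2⟩)
    have hWi : ∀ i, W i ≤ W0ᗮ := fun i => (le_iSup W i).trans (h2.le.trans inf_le_left)
    refine ⟨r + 1, Fin.cons W0 W, ?_, ?_, ?_, ?_, ?_⟩
    · intro i j hij
      induction i using Fin.cases with
      | zero =>
        induction j using Fin.cases with
        | zero => exact absurd rfl hij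
        | succ j =>
          simp only [Fin.cons_zero, Fin.cons_succ]
          exact (Submodule.le_orthogonal_orthogonal W0).trans (Submodule.orthogonal_le (hWi j))
      | succ i =>
        induction j using Fin.cases with
        | zero => simpa using hWi i
        | succ j =>
          simp only [Fin.cons_succ]
          exact h1 i j fun h => hij (by rw [h])
    · rw [← hsup, ← h2]
      apply le_antisymm
      · refine iSup_le fun i => ?_
        induction i using Fin.cases with
        | zero => exact le_sup_left
        | succ i => exact (le_iSup W i).trans le_sup_right
      · refine sup_le ?_ (iSup_le fun i => ?_)
        · exact le_iSup (Fin.cons W0 W : Fin (r + 1) → Submodule ℂ V) 0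
        · exact le_iSup (Fin.cons W0 W : Fin (r + 1) → Submodule ℂ V) i.succ
    · exact fun i => Fin.cases hd h3 i
    · exact fun i => Fin.cases hPW h4 i
    · exact fun i => Fin.cases hQW h5 i

lemma aux_rank {M : Type*} [AddCommGroup M] [Module ℂ M] [FiniteDimensional ℂ M]
    (hM : finrank ℂ M = 2) (R : M →ₗ[ℂ] M) (hR : ∀ x, R (R x) = R x)
    (h0 : R ≠ 0) (h1 : R ≠ LinearMap.id) : finrank ℂ (LinearMap.range R) = 1 := by
  have hle := Submodule.finrank_le (LinearMap.range R)
  have hn0 : finrank ℂ (LinearMap.range R) ≠ 0 := fun h =>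
    h0 (LinearMap.range_eq_bot.mp (Submodule.finrank_eq_zero.mp h))
  have hn2 : finrank ℂ (LinearMap.range R) ≠ 2 := fun h => by
    have ht : LinearMap.range R = ⊤ := Submodule.eq_top_of_finrank_eq (h.trans hM.symm)
    apply h1
    ext x
    obtain ⟨y, rfl⟩ := LinearMap.range_eq_top.mp ht x
    exact hR y
  omega


/-- two orthogonal projections `P, Q` (self-adjoint idempotents) on a
finite-dimensional complex inner product space `V` admit a common decomposition of
`V` into an internal orthogonal direct sum of subspaces `W 1, …, W r` of dimension
at most 2, each invariant under both `P` and `Q`; moreover, on every two-dimensional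
summand on which neither of the two restrictions is `0` or the identity, the
restrictions of `P` and of `Q` are rank-one orthogonal projections (being restrictions
of orthogonal projections they are automatically self-adjoint idempotents, so this is
expressed by their ranges having dimension 1). -/
theorem stmt1 (V : Type*) [NormedAddCommGroup V] [InnerProductSpace ℂ V]
    [FiniteDimensional ℂ V]
    (P Q : V →ₗ[ℂ] V)
    (hP2 : P ∘ₗ P = P) (hQ2 : Q ∘ₗ Q = Q)
    (hPsa : P.IsSymmetric) (hQsa : Q.IsSymmetric) :
    ∃ (r : ℕ) (W : Fin r → Submodule ℂ V),
      (∀ i j, i ≠ j → W i ≤ (W j)ᗮ) ∧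
      (⨆ i, W i) = ⊤ ∧
      (∀ i, Module.finrank ℂ (W i) ≤ 2) ∧
      ∃ (hPW : ∀ i, ∀ x ∈ W i, P x ∈ W i) (hQW : ∀ i, ∀ x ∈ W i, Q x ∈ W i),
        ∀ i, Module.finrank ℂ (W i) = 2 →
          (P.restrict (hPW i) ≠ 0 ∧ P.restrict (hPW i) ≠ LinearMap.id ∧
           Q.restrict (hQW i) ≠ 0 ∧ Q.restrict (hQW i) ≠ LinearMap.id) →
          Module.finrank ℂ (LinearMap.range (P.restrict (hPW i))) = 1 ∧
          Module.finrank ℂ (LinearMap.range (Q.restrict (hQW i))) = 1 := by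

  have hP : ∀ x, P (P x) = P x := fun x => LinearMap.congr_fun hP2 x
  have hQ : ∀ x, Q (Q x) = Q x := fun x => LinearMap.congr_fun hQ2 x
  obtain ⟨r, W, h1, h2, h3, h4, h5⟩ := aux_dec P Q hP hQ hPsa hQsa _ ⊤ le_rfl
    (fun _ _ => trivial) (fun _ _ => trivial)
  refine ⟨r, W, h1, h2, h3, h4, h5, fun i hi ⟨a, b, c, d⟩ => ⟨?_, ?_⟩⟩
  · exact aux_rank hi _ (fun x => Subtype.ext (hP x)) a b
  · exact aux_rank hi _ (fun x => Subtype.ext (hQ x)) c d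
end

section
/- Let N ≥ 2 and let ρ be an N-qubit density matrix (a positive-semidefinite complex 2^N × 2^N matrix of trace 1). For each party i ∈ {1,…,N} and input x ∈ {0,1}, let a^i_x ∈ ℝ³ be a unit vector and set the observable A^(i)_x = a^i_x·σ⃗ (a 2×2 Hermitian matrix). Let M_N be the N-partite MABK operator built from these observables via the recursion M₂ = A^(1)₀⊗A^(2)₀ + A^(1)₀⊗A^(2)₁ + A^(1)₁⊗A^(2)₀ − A^(1)₁⊗A^(2)₁ and M_N = (1/2)[ M_{N−1}⊗A^(N)₀ + M_{N−1}⊗A^(N)₁ + M̄_{N−1}⊗A^(N)₀ − M̄_{N−1}⊗A^(N)₁ ], where M̄_{N−1} is obtained from M_{N−1} by exchanging every A^(i)₀ with A^(i)₁. Let T_ρ be the 3^⌈N/2⌉ × 3^⌊N/2⌋ correlation matrix of ρ, and let t₀, t₁ be the largest and second-largest eigenvalues of T_ρ·T_ρᵀ. Then Tr[M_N ρ] ≤ 2√(t₀ + t₁). -/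
open BigOperators Matrix
open scoped ComplexOrder

/-- The Pauli matrices `σ₁ = X`, `σ₂ = Y`, `σ₃ = Z` (indexed by `Fin 3`). -/
noncomputable def pauli : Fin 3 → Matrix (Fin 2) (Fin 2) ℂ
  | 0 => !![0, 1; 1, 0]
  | 1 => !![0, -Complex.I; Complex.I, 0]
  | 2 => !![1, 0; 0, -1]

/-- The observable `a·σ⃗ = a₁σ₁ + a₂σ₂ + a₃σ₃` associated to a vector `a ∈ ℝ³`. -/
noncomputable def obs (a : Fin 3 → ℝ) : Matrix (Fin 2) (Fin 2) ℂ :=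
  ∑ i, (a i : ℂ) • pauli i

/-- Tensor (Kronecker) product of `N` single-qubit operators, as a matrix indexed by
`Fin N → Fin 2`. -/
noncomputable def tensorN {N : ℕ} (A : Fin N → Matrix (Fin 2) (Fin 2) ℂ) :
    Matrix (Fin N → Fin 2) (Fin N → Fin 2) ℂ :=
  fun r c => ∏ i, A i (r i) (c i)

/-- Kronecker product `M ⊗ B` appending one qubit at the end. -/
noncomputable def kronSnoc {n : ℕ}
    (M : Matrix (Fin n → Fin 2) (Fin n → Fin 2) ℂ) (B : Matrix (Fin 2) (Fin 2) ℂ) :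
    Matrix (Fin (n + 1) → Fin 2) (Fin (n + 1) → Fin 2) ℂ :=
  fun r c => M (fun i => r i.castSucc) (fun i => c i.castSucc)
    * B (r (Fin.last n)) (c (Fin.last n))

/-- Kronecker product of two single-qubit operators, indexed by `Fin 2 → Fin 2`. -/
noncomputable def pairT (A B : Matrix (Fin 2) (Fin 2) ℂ) :
    Matrix (Fin 2 → Fin 2) (Fin 2 → Fin 2) ℂ :=
  fun r c => A (r 0) (c 0) * B (r 1) (c 1)

/-- The `N`-partite MABK operator built from the observables `A i x` of party `i`
with input `x`, via the recursion
`M₂ = A⁽¹⁾₀⊗A⁽²⁾₀ + A⁽¹⁾₀⊗A⁽²⁾₁ + A⁽¹⁾₁⊗A⁽²⁾₀ − A⁽¹⁾₁⊗A⁽²⁾₁` and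
`M_N = ½[M_{N−1}⊗A⁽ᴺ⁾₀ + M_{N−1}⊗A⁽ᴺ⁾₁ + M̄_{N−1}⊗A⁽ᴺ⁾₀ − M̄_{N−1}⊗A⁽ᴺ⁾₁]`,
where `M̄_{N−1}` is `M_{N−1}` with every observable `A i x` replaced by `A i (1−x)`
(values at `N = 0, 1` are irrelevant and set to `0`). -/
noncomputable def MABK : (N : ℕ) → (Fin N → Fin 2 → Matrix (Fin 2) (Fin 2) ℂ) →
    Matrix (Fin N → Fin 2) (Fin N → Fin 2) ℂ
  | 0, _ => 0
  | 1, _ => 0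
  | 2, A => pairT (A 0 0) (A 1 0) + pairT (A 0 0) (A 1 1)
      + pairT (A 0 1) (A 1 0) - pairT (A 0 1) (A 1 1)
  | (N + 3), A =>
      (1 / 2 : ℂ) •
        (kronSnoc (MABK (N + 2) (fun i x => A i.castSucc x)) (A (Fin.last (N + 2)) 0)
        + kronSnoc (MABK (N + 2) (fun i x => A i.castSucc x)) (A (Fin.last (N + 2)) 1)
        + kronSnoc (MABK (N + 2) (fun i x => A i.castSucc (1 - x))) (A (Fin.last (N + 2)) 0)
        - kronSnoc (MABK (N + 2) (fun i x => A i.castSucc (1 - x))) (A (Fin.last (N + 2)) 1))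

/-- The `3^⌈N/2⌉ × 3^⌊N/2⌋` correlation matrix of an `N`-qubit state, with rows indexed
by the Pauli labels of the first `⌈N/2⌉ = (N+1)/2` parties and columns by those of the
last `⌊N/2⌋ = N/2` parties; entries are `Tr[ρ·σ_{ν₁}⊗…⊗σ_{ν_N}]` (real, since the
traced operators are Hermitian). -/
noncomputable def corrMat (N : ℕ)
    (ρ : Matrix (Fin N → Fin 2) (Fin N → Fin 2) ℂ) :
    Matrix (Fin ((N + 1) / 2) → Fin 3) (Fin (N / 2) → Fin 3) ℝ :=
  fun r c => (Matrix.trace (ρ * tensorN (fun i : Fin N =>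
    pauli (if h : (i : ℕ) < (N + 1) / 2 then r ⟨i, h⟩
      else c ⟨(i : ℕ) - (N + 1) / 2, by have := i.isLt; omega⟩)))).re

/-! ### Scalar recursion -/

/-- The scalar MABK composition. -/
noncomputable def comb (v w : ℝ × ℝ) : ℝ × ℝ :=
  ((v.1 * w.1 + v.1 * w.2 + v.2 * w.1 - v.2 * w.2) / 2,
   (v.2 * w.2 + v.2 * w.1 + v.1 * w.2 - v.1 * w.1) / 2)

noncomputable def WW : (n : ℕ) → (Fin n → Fin 2 → ℝ) → ℝ × ℝ
  | 0, _ => (1, 1)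
  | (n + 1), b => comb (WW n (fun i => b i.castSucc)) (b (Fin.last n) 0, b (Fin.last n) 1)

lemma WW_split (k l : ℕ) (b : Fin (k + l) → Fin 2 → ℝ) :
    WW (k + l) b = comb (WW k (fun i => b (Fin.castAdd l i))) (WW l (fun i => b (Fin.natAdd k i))) := by
  induction l with
  | zero =>
    have : WW (k + 0) b = WW k (fun i => b (Fin.castAdd 0 i)) := rfl
    rw [this]
    simp only [WW, comb]
    ext <;> simp <;> ring
  | succ l ih =>
    have h1 : WW (k + (l + 1)) b = comb (WW (k + l) (fun i => b i.castSucc))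
      (b (Fin.last (k + l)) 0, b (Fin.last (k + l)) 1) := rfl
    have h2 : WW (l + 1) (fun i => b (Fin.natAdd k i)) =
      comb (WW l (fun i => b (Fin.natAdd k i).castSucc))
      (b (Fin.last (k + l)) 0, b (Fin.last (k + l)) 1) := rfl
    have h3 : (fun i => b (Fin.castAdd (l + 1) i)) = fun i => b (Fin.castAdd l i).castSucc := rfl
    rw [h1, h2, ih, h3]
    simp only [comb]
    ext <;> simp only <;> ring

lemma WW_flip (n : ℕ) (b : Fin n → Fin 2 → ℝ) :
    WW n (fun i x => b i (1 - x)) = (WW n b).swap := by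
  induction n with
  | zero => rfl
  | succ n ih =>
    simp only [WW]
    rw [ih (fun i => b i.castSucc)]
    simp only [comb, Prod.fst_swap, Prod.snd_swap, Prod.swap_prod_mk]
    have e1 : (1 : Fin 2) - 0 = 1 := rfl
    have e2 : (1 : Fin 2) - 1 = 0 := rfl
    rw [e1, e2]

/-- sum over functions on `Fin (n+1)` via snoc -/
lemma sum_snoc {M : Type*} [AddCommMonoid M] (n : ℕ) (f : (Fin (n + 1) → Fin 3) → M) :
    ∑ ν, f ν = ∑ μ : Fin n → Fin 3, ∑ t : Fin 3, f (Fin.snoc (α := fun _ => Fin 3) μ t) := by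
  rw [← (Fin.snocEquiv (fun _ : Fin (n + 1) => Fin 3)).sum_comp, Fintype.sum_prod_type,
    Finset.sum_comm]
  rfl

lemma WW_norm (n : ℕ) (a : Fin n → Fin 2 → Fin 3 → ℝ) (ha : ∀ i x, ∑ t, a i x t ^ 2 = 1) :
    ∑ ν : Fin n → Fin 3, (WW n (fun i x => a i x (ν i))).1 ^ 2 = 1 ∧
    ∑ ν : Fin n → Fin 3, (WW n (fun i x => a i x (ν i))).2 ^ 2 = 1 := by
  induction n with
  | zero => simp [WW]
  | succ n ih =>
    obtain ⟨i1, i2⟩ := ih (fun i => a i.castSucc) (fun i x => ha _ x)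
    have c0 := ha (Fin.last n) 0
    have c1 := ha (Fin.last n) 1
    rw [Fin.sum_univ_three] at c0 c1
    set g := ∑ t, a (Fin.last n) 0 t * a (Fin.last n) 1 t with hg
    rw [Fin.sum_univ_three] at hg
    constructor
    · rw [sum_snoc]
      have : ∀ μ : Fin n → Fin 3, ∑ t, (WW (n + 1) (fun i x => a i x
          ((Fin.snoc (α := fun _ => Fin 3) μ t : Fin (n + 1) → Fin 3) i))).1 ^ 2
          = (1 + g) / 2 * (WW n (fun i x => a i.castSucc x (μ i))).1 ^ 2
          + (1 - g) / 2 * (WW n (fun i x => a i.castSucc x (μ i))).2 ^ 2 := by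
        intro μ
        simp only [WW, comb, Fin.snoc_castSucc, Fin.snoc_last, Fin.sum_univ_three]
        generalize WW n (fun i x => a i.castSucc x (μ i)) = w
        rw [hg]
        linear_combination (w.1 ^ 2 + w.2 ^ 2 + 2 * w.1 * w.2) / 4 * c0
          + (w.1 ^ 2 + w.2 ^ 2 - 2 * w.1 * w.2) / 4 * c1
      simp only [this]
      rw [Finset.sum_add_distrib, ← Finset.mul_sum, ← Finset.mul_sum, i1, i2]
      ring
    · rw [sum_snoc]
      have : ∀ μ : Fin n → Fin 3, ∑ t, (WW (n + 1) (fun i x => a i x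
          ((Fin.snoc (α := fun _ => Fin 3) μ t : Fin (n + 1) → Fin 3) i))).2 ^ 2
          = (1 - g) / 2 * (WW n (fun i x => a i.castSucc x (μ i))).1 ^ 2
          + (1 + g) / 2 * (WW n (fun i x => a i.castSucc x (μ i))).2 ^ 2 := by
        intro μ
        simp only [WW, comb, Fin.snoc_castSucc, Fin.snoc_last, Fin.sum_univ_three]
        generalize WW n (fun i x => a i.castSucc x (μ i)) = w
        rw [hg]
        linear_combination (w.1 ^ 2 + w.2 ^ 2 - 2 * w.1 * w.2) / 4 * c0
          + (w.1 ^ 2 + w.2 ^ 2 + 2 * w.1 * w.2) / 4 * c1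
      simp only [this]
      rw [Finset.sum_add_distrib, ← Finset.mul_sum, ← Finset.mul_sum, i1, i2]
      ring

/-! ### Pauli expansion of the MABK operator -/

noncomputable def XX (n : ℕ) (a : Fin n → Fin 2 → Fin 3 → ℝ) :
    Matrix (Fin n → Fin 2) (Fin n → Fin 2) ℂ :=
  fun r c => ∑ ν : Fin n → Fin 3, ((WW n (fun i x => a i x (ν i))).1 : ℂ) *
    ∏ i, pauli (ν i) (r i) (c i)

lemma XX_succ (n : ℕ) (a : Fin (n + 1) → Fin 2 → Fin 3 → ℝ) :
    XX (n + 1) a = (1 / 2 : ℂ) •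
        (kronSnoc (XX n (fun i x => a i.castSucc x)) (obs (a (Fin.last n) 0))
        + kronSnoc (XX n (fun i x => a i.castSucc x)) (obs (a (Fin.last n) 1))
        + kronSnoc (XX n (fun i x => a i.castSucc (1 - x))) (obs (a (Fin.last n) 0))
        - kronSnoc (XX n (fun i x => a i.castSucc (1 - x))) (obs (a (Fin.last n) 1))) := by
  ext r c
  simp only [XX, kronSnoc, Matrix.smul_apply, Matrix.add_apply, Matrix.sub_apply, smul_eq_mul]
  rw [sum_snoc]
  simp only [Finset.sum_mul, ← Finset.sum_add_distrib, ← Finset.sum_sub_distrib, Finset.mul_sum]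
  refine Finset.sum_congr rfl fun μ _ => ?_
  rw [WW_flip n (fun i x => a i.castSucc x (μ i))]
  simp only [WW, comb, Fin.snoc_castSucc, Fin.snoc_last, Fin.sum_univ_three, Fin.prod_univ_castSucc,
    obs, Matrix.add_apply, Matrix.smul_apply, smul_eq_mul, Prod.fst_swap]
  push_cast
  ring

lemma kron_zero (a : Fin 0 → Fin 2 → Fin 3 → ℝ) : XX 0 a = fun _ _ => 1 := by
  ext r c
  simp [XX, WW]

lemma MABK_eq (n : ℕ) (a : Fin (n + 2) → Fin 2 → Fin 3 → ℝ) :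
    MABK (n + 2) (fun i x => obs (a i x)) = (2 : ℂ) • XX (n + 2) a := by
  induction n with
  | zero =>
    simp only [XX_succ, kron_zero]
    ext r c
    have e1 : (1 : Fin 2) - 0 = 1 := rfl
    have e2 : (1 : Fin 2) - 1 = 0 := rfl
    have e3 : (Fin.last 0).castSucc = (0 : Fin 2) := rfl
    have e4 : Fin.last 1 = (1 : Fin 2) := rfl
    simp only [MABK, pairT, kronSnoc, Matrix.smul_apply, Matrix.add_apply, Matrix.sub_apply,
      smul_eq_mul, Nat.reduceAdd, zero_add, e1, e2, e3, e4]
    ring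
  | succ n ih =>
    rw [XX_succ]
    have h1 := ih (fun i x => a i.castSucc x)
    have h2 := ih (fun i x => a i.castSucc (1 - x))
    show (1 / 2 : ℂ) • (kronSnoc (MABK (n + 2) (fun i x => obs (a i.castSucc x))) _ + kronSnoc (MABK (n + 2) (fun i x => obs (a i.castSucc x))) _ + kronSnoc (MABK (n + 2) (fun i x => obs (a i.castSucc (1 - x)))) _ - kronSnoc (MABK (n + 2) (fun i x => obs (a i.castSucc (1 - x)))) _) = _
    rw [h1, h2]
    ext r c
    simp only [kronSnoc, Matrix.smul_apply, Matrix.add_apply, Matrix.sub_apply,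
      smul_eq_mul]
    ring

lemma MABK_eq_ge (N : ℕ) (hN : 2 ≤ N) (a : Fin N → Fin 2 → Fin 3 → ℝ) :
    MABK N (fun i x => obs (a i x)) = (2 : ℂ) • XX N a := by
  obtain ⟨n, rfl⟩ := Nat.exists_eq_add_of_le' hN
  exact MABK_eq n a

lemma trace_XX (n : ℕ) (a : Fin n → Fin 2 → Fin 3 → ℝ)
    (ρ : Matrix (Fin n → Fin 2) (Fin n → Fin 2) ℂ) :
    (Matrix.trace (XX n a * ρ)).re = ∑ ν : Fin n → Fin 3,
      (WW n (fun i x => a i x (ν i))).1 *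
        (Matrix.trace (ρ * tensorN (fun i => pauli (ν i)))).re := by
  have : XX n a = ∑ ν : Fin n → Fin 3,
      ((WW n (fun i x => a i x (ν i))).1 : ℂ) • tensorN (fun i => pauli (ν i)) := by
    ext r c
    simp [XX, tensorN, Matrix.sum_apply]
  rw [Matrix.trace_mul_comm, this, Finset.mul_sum, Matrix.trace_sum, Complex.re_sum]
  refine Finset.sum_congr rfl fun ν _ => ?_
  rw [Matrix.mul_smul, Matrix.trace_smul, smul_eq_mul, Complex.re_ofReal_mul]

/-- the bipartite form -/
lemma bip (N k l : ℕ) (h : N = k + l) (hN : 2 ≤ N)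
    (ρ : Matrix (Fin N → Fin 2) (Fin N → Fin 2) ℂ)
    (a : Fin N → Fin 2 → Fin 3 → ℝ) (ha : ∀ i x, ∑ t, a i x t ^ 2 = 1)
    (T : Matrix (Fin k → Fin 3) (Fin l → Fin 3) ℝ)
    (hT : ∀ r c, T r c = (Matrix.trace (ρ * tensorN (fun i : Fin N =>
    pauli (if h : (i : ℕ) < k then r ⟨i, h⟩
      else c ⟨(i : ℕ) - k, by have := i.isLt; omega⟩)))).re) :
    ∃ (u v : (Fin k → Fin 3) → ℝ) (u' v' : (Fin l → Fin 3) → ℝ),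
      ∑ r, u r ^ 2 = 1 ∧ ∑ r, v r ^ 2 = 1 ∧ ∑ r, u' r ^ 2 = 1 ∧ ∑ r, v' r ^ 2 = 1 ∧
      (Matrix.trace (MABK N (fun i x => obs (a i x)) * ρ)).re =
        ∑ c, (∑ r, (u r + v r) * T r c) * u' c + ∑ c, (∑ r, (u r - v r) * T r c) * v' c := by
  subst h
  refine ⟨fun r => (WW k (fun i x => a (Fin.castAdd l i) x (r i))).1,
    fun r => (WW k (fun i x => a (Fin.castAdd l i) x (r i))).2,
    fun c => (WW l (fun i x => a (Fin.natAdd k i) x (c i))).1,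
    fun c => (WW l (fun i x => a (Fin.natAdd k i) x (c i))).2,
    (WW_norm k _ fun i x => ha _ x).1, (WW_norm k _ fun i x => ha _ x).2,
    (WW_norm l _ fun i x => ha _ x).1, (WW_norm l _ fun i x => ha _ x).2, ?_⟩
  have hM : MABK (k + l) (fun i x => obs (a i x)) = (2 : ℂ) • XX (k + l) a := by
    exact MABK_eq_ge (k + l) hN a
  rw [hM, Matrix.smul_mul, Matrix.trace_smul, smul_eq_mul]
  have : ((2 : ℂ) * (XX (k + l) a * ρ).trace).re = 2 * (XX (k + l) a * ρ).trace.re := by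
    simp
  rw [this, trace_XX, ← (Fin.appendEquiv (α := Fin 3) k l).sum_comp, Fintype.sum_prod_type,
    Finset.sum_comm, Finset.mul_sum, ← Finset.sum_add_distrib]
  refine Finset.sum_congr rfl fun c _ => ?_
  rw [Finset.mul_sum, Finset.sum_mul, Finset.sum_mul, ← Finset.sum_add_distrib]
  refine Finset.sum_congr rfl fun r _ => ?_
  have hh : (Matrix.trace (ρ * tensorN (fun i => pauli ((Fin.appendEquiv k l) (r, c) i)))).re
      = T r c := by
    rw [hT]
    congr 4
    ext1 i
    congr 1
    refine Fin.addCases (fun i => ?_) (fun i => ?_) i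
    · simp [Fin.appendEquiv]
    · simp [Fin.appendEquiv]
  rw [hh, WW_split]
  simp only [Fin.appendEquiv, Equiv.coe_fn_mk, Fin.append_left, Fin.append_right, comb]
  ring

/-! ### Linear algebra -/

lemma bessel2 {ι : Type*} [Fintype ι] [DecidableEq ι] (x y : ι → ℝ) (P Q : ℝ)
    (hP : 0 < P) (hQ : 0 < Q)
    (hx : ∑ k, x k ^ 2 = P) (hy : ∑ k, y k ^ 2 = Q) (hxy : ∑ k, x k * y k = 0) (i : ι) :
    x i ^ 2 / P + y i ^ 2 / Q ≤ 1 := by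
  have h : 0 ≤ ∑ k, (x i / P * x k + y i / Q * y k - if k = i then 1 else 0) ^ 2 :=
    Finset.sum_nonneg fun k _ => sq_nonneg _
  have e : ∑ k, (x i / P * x k + y i / Q * y k - if k = i then 1 else 0) ^ 2 =
      (x i / P) ^ 2 * ∑ k, x k ^ 2 + (y i / Q) ^ 2 * ∑ k, y k ^ 2
      + 2 * (x i / P) * (y i / Q) * ∑ k, x k * y k
      + ∑ k, (if k = i then 1 - 2 * (x i / P * x k + y i / Q * y k) else 0) := by
    simp only [Finset.mul_sum, ← Finset.sum_add_distrib]
    refine Finset.sum_congr rfl fun k _ => ?_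
    split_ifs <;> ring
  rw [e, hx, hy, hxy, Finset.sum_ite_eq' Finset.univ i] at h
  simp only [Finset.mem_univ, if_true] at h
  have e2 : (x i / P) ^ 2 * P + (y i / Q) ^ 2 * Q + 2 * (x i / P) * (y i / Q) * 0
      + (1 - 2 * (x i / P * x i + y i / Q * y i)) = 1 - (x i ^ 2 / P + y i ^ 2 / Q) := by
    field_simp
    ring
  linarith

lemma kyfan {ι : Type*} [Fintype ι] [DecidableEq ι] (lam x y : ι → ℝ) (P Q t₀ t₁ : ℝ)
    (hP : 0 < P) (hQ : 0 < Q)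
    (hx : ∑ k, x k ^ 2 = P) (hy : ∑ k, y k ^ 2 = Q) (hxy : ∑ k, x k * y k = 0) (i : ι)
    (h0 : lam i = t₀) (h01 : t₁ ≤ t₀) (h1 : ∀ k, k ≠ i → lam k ≤ t₁) :
    (∑ k, lam k * x k ^ 2) / P + (∑ k, lam k * y k ^ 2) / Q ≤ t₀ + t₁ := by
  have hb := bessel2 x y P Q hP hQ hx hy hxy i
  set w : ι → ℝ := fun k => x k ^ 2 / P + y k ^ 2 / Q with hw
  have hw0 : ∀ k, 0 ≤ w k := fun k => by positivity
  have hws : ∑ k, w k = 2 := by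
    simp only [hw]
    rw [Finset.sum_add_distrib, ← Finset.sum_div, ← Finset.sum_div, hx, hy, div_self hP.ne',
      div_self hQ.ne']
    norm_num
  have e : (∑ k, lam k * x k ^ 2) / P + (∑ k, lam k * y k ^ 2) / Q = ∑ k, lam k * w k := by
    rw [Finset.sum_div, Finset.sum_div, ← Finset.sum_add_distrib]
    refine Finset.sum_congr rfl fun k _ => ?_
    simp only [hw]
    ring
  have l : ∑ k, lam k * w k ≤ ∑ k, (t₁ * w k + if k = i then (t₀ - t₁) * w k else 0) := by
    refine Finset.sum_le_sum fun k _ => ?_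
    split_ifs with hk
    · subst hk
      rw [h0]
      linarith
    · have := mul_le_mul_of_nonneg_right (h1 k hk) (hw0 k)
      linarith
  rw [Finset.sum_add_distrib, ← Finset.mul_sum, hws, Finset.sum_ite_eq' Finset.univ i] at l
  simp only [Finset.mem_univ, if_true] at l
  have hwi : w i ≤ 1 := hb
  rw [e]
  nlinarith

/-- coordinates in the eigenbasis -/
noncomputable def crd {m : Type*} [Fintype m] [DecidableEq m]
    {A : Matrix m m ℝ} (hH : A.IsHermitian) (p : m → ℝ) (k : m) : ℝ :=
  inner ℝ (hH.eigenvectorBasis k) (WithLp.toLp 2 p)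

lemma crd_inner {m : Type*} [Fintype m] [DecidableEq m]
    {A : Matrix m m ℝ} (hH : A.IsHermitian) (p q : m → ℝ) :
    ∑ k, crd hH p k * crd hH q k = ∑ r, p r * q r := by
  have h := hH.eigenvectorBasis.sum_inner_mul_inner (WithLp.toLp 2 p) (WithLp.toLp 2 q)
  have h2 : inner ℝ (WithLp.toLp 2 p) (WithLp.toLp 2 q : EuclideanSpace ℝ m) = ∑ r, p r * q r := by
    simp [PiLp.inner_apply, mul_comm]
  rw [← h2, ← h]
  refine Finset.sum_congr rfl fun k _ => ?_
  simp only [crd]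
  rw [real_inner_comm]

lemma crd_mulVec {m : Type*} [Fintype m] [DecidableEq m]
    {A : Matrix m m ℝ} (hH : A.IsHermitian) (p : m → ℝ) (k : m) :
    crd hH (A *ᵥ p) k = hH.eigenvalues k * crd hH p k := by
  have e : ∀ q : m → ℝ, crd hH q k = (hH.eigenvectorBasis k).ofLp ⬝ᵥ q := by
    intro q
    simp [crd, PiLp.inner_apply, dotProduct, mul_comm]
  have hA : Aᵀ = A := by
    have := hH.eq
    rwa [Matrix.conjTranspose_eq_transpose_of_trivial] at this
  rw [e, e, Matrix.dotProduct_mulVec, ← Matrix.mulVec_transpose, hA, hH.mulVec_eigenvectorBasis,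
    smul_dotProduct, smul_eq_mul]

lemma quad {m n : Type*} [Fintype m] [DecidableEq m] [Fintype n]
    (T : Matrix m n ℝ) (hH : (T * Tᵀ).IsHermitian) (p : m → ℝ) :
    ∑ c, (∑ r, p r * T r c) ^ 2 = ∑ k, hH.eigenvalues k * crd hH p k ^ 2 := by
  have h := crd_inner hH p ((T * Tᵀ) *ᵥ p)
  have h1 : ∑ r, p r * ((T * Tᵀ) *ᵥ p) r = ∑ c, (∑ r, p r * T r c) ^ 2 := by
    have e1 : ∑ r, p r * ((T * Tᵀ) *ᵥ p) r = p ⬝ᵥ ((T * Tᵀ) *ᵥ p) := rfl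
    rw [e1, ← Matrix.mulVec_mulVec, Matrix.dotProduct_mulVec, Matrix.mulVec_transpose]
    simp [dotProduct, Matrix.vecMul, pow_two]
  rw [← h1, ← h]
  refine Finset.sum_congr rfl fun k _ => ?_
  rw [crd_mulVec]
  ring

lemma final {m n : Type*} [Fintype m] [DecidableEq m] [Fintype n]
    (T : Matrix m n ℝ) (hH : (T * Tᵀ).IsHermitian) (t₀ t₁ : ℝ) (i j : m) 
    (ht₀ : t₀ = hH.eigenvalues i) (ht₁ : t₁ = hH.eigenvalues j)
    (hmax : ∀ k, hH.eigenvalues k ≤ t₀)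
    (hsec : ∀ k, k ≠ i → hH.eigenvalues k ≤ t₁)
    (u v : m → ℝ) (u' v' : n → ℝ)
    (hu : ∑ r, u r ^ 2 = 1) (hv : ∑ r, v r ^ 2 = 1)
    (hu' : ∑ r, u' r ^ 2 = 1) (hv' : ∑ r, v' r ^ 2 = 1) :
    ∑ c, (∑ r, (u r + v r) * T r c) * u' c + ∑ c, (∑ r, (u r - v r) * T r c) * v' c
      ≤ 2 * Real.sqrt (t₀ + t₁) := by
  have hnn : ∀ k, 0 ≤ hH.eigenvalues k := by
    have hp : (T * Tᵀ).PosSemidef := by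
      have := Matrix.posSemidef_self_mul_conjTranspose T
      rwa [Matrix.conjTranspose_eq_transpose_of_trivial] at this
    exact fun k => hp.eigenvalues_nonneg k
  have h01 : t₁ ≤ t₀ := ht₁ ▸ hmax j
  have ht1 : 0 ≤ t₁ := ht₁ ▸ hnn j
  set p : m → ℝ := fun r => u r + v r with hp
  set q : m → ℝ := fun r => u r - v r with hq
  set s₁ := ∑ c, (∑ r, (u r + v r) * T r c) * u' c
  set s₂ := ∑ c, (∑ r, (u r - v r) * T r c) * v' c
  have hs1 : s₁ ^ 2 ≤ ∑ k, hH.eigenvalues k * crd hH p k ^ 2 := by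
    have := Finset.sum_mul_sq_le_sq_mul_sq Finset.univ (fun c => ∑ r, p r * T r c) u'
    rw [hu', mul_one, quad T hH p] at this
    exact this
  have hs2 : s₂ ^ 2 ≤ ∑ k, hH.eigenvalues k * crd hH q k ^ 2 := by
    have := Finset.sum_mul_sq_le_sq_mul_sq Finset.univ (fun c => ∑ r, q r * T r c) v'
    rw [hv', mul_one, quad T hH q] at this
    exact this
  set P := ∑ k, crd hH p k ^ 2 with hP
  set Q := ∑ k, crd hH q k ^ 2 with hQ
  have hpq : ∑ k, crd hH p k * crd hH q k = 0 := by
    rw [crd_inner]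
    have : ∑ r, p r * q r = ∑ r, u r ^ 2 - ∑ r, v r ^ 2 := by
      rw [← Finset.sum_sub_distrib]
      exact Finset.sum_congr rfl fun r _ => by simp only [hp, hq]; ring
    rw [this, hu, hv, sub_self]
  have hPQ : P + Q = 4 := by
    have e1 : P = ∑ r, p r * p r := by
      rw [← crd_inner hH, hP]
      exact Finset.sum_congr rfl fun r _ => pow_two _
    have e2 : Q = ∑ r, q r * q r := by
      rw [← crd_inner hH, hQ]
      exact Finset.sum_congr rfl fun r _ => pow_two _
    have : ∑ r, p r * p r + ∑ r, q r * q r = 2 * ∑ r, u r ^ 2 + 2 * ∑ r, v r ^ 2 := by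
      rw [Finset.mul_sum, Finset.mul_sum, ← Finset.sum_add_distrib, ← Finset.sum_add_distrib]
      exact Finset.sum_congr rfl fun r _ => by simp only [hp, hq]; ring
    rw [e1, e2, this, hu, hv]
    norm_num
  have hP0 : 0 ≤ P := Finset.sum_nonneg fun k _ => sq_nonneg _
  have hQ0 : 0 ≤ Q := Finset.sum_nonneg fun k _ => sq_nonneg _
  have b1 : ∑ k, hH.eigenvalues k * crd hH p k ^ 2 ≤ t₀ * P := by
    rw [hP, Finset.mul_sum]
    exact Finset.sum_le_sum fun k _ => mul_le_mul_of_nonneg_right (hmax k) (sq_nonneg _)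
  have b2 : ∑ k, hH.eigenvalues k * crd hH q k ^ 2 ≤ t₀ * Q := by
    rw [hQ, Finset.mul_sum]
    exact Finset.sum_le_sum fun k _ => mul_le_mul_of_nonneg_right (hmax k) (sq_nonneg _)
  have key : (s₁ + s₂) ^ 2 ≤ 4 * (t₀ + t₁) := by
    rcases hP0.eq_or_lt with h | h
    · rw [← h] at b1 hPQ
      have z : s₁ = 0 := by nlinarith
      rw [z, zero_add]
      nlinarith
    rcases hQ0.eq_or_lt with h' | h'
    · rw [← h'] at b2 hPQ
      have z : s₂ = 0 := by nlinarith
      rw [z, add_zero]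
      nlinarith
    have kf := kyfan hH.eigenvalues (crd hH p) (crd hH q) P Q t₀ t₁ h h' rfl rfl hpq i
      ht₀.symm h01 hsec
    have c1 : s₁ ^ 2 / P + s₂ ^ 2 / Q ≤ t₀ + t₁ :=
      le_trans (add_le_add (div_le_div_of_nonneg_right hs1 hP0)
        (div_le_div_of_nonneg_right hs2 hQ0)) kf
    have c2 : (s₁ + s₂) ^ 2 / (P + Q) ≤ s₁ ^ 2 / P + s₂ ^ 2 / Q := by
      rw [div_add_div _ _ h.ne' h'.ne', div_le_div_iff₀ (by positivity) (by positivity)]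
      nlinarith [sq_nonneg (Q * s₁ - P * s₂)]
    rw [hPQ] at c2
    linarith
  have := Real.le_sqrt_of_sq_le key
  rwa [Real.sqrt_mul (by norm_num), show Real.sqrt 4 = 2 by
    rw [show (4 : ℝ) = 2 ^ 2 by norm_num]; exact Real.sqrt_sq (by norm_num)] at this

/-- for `N ≥ 2`, an `N`-qubit density matrix `ρ`, and rank-one projective
observables `A⁽ⁱ⁾_x = a i x · σ⃗` built from unit vectors `a i x ∈ ℝ³`, the MABK
expectation satisfies `Tr[M_N ρ] ≤ 2√(t₀+t₁)`, where `t₀, t₁` are the largest and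
second-largest eigenvalues (with multiplicity) of `T_ρ·T_ρᵀ`, with `T_ρ` the
correlation matrix of `ρ`. -/
theorem stmt2 (N : ℕ) (hN : 2 ≤ N)
    (ρ : Matrix (Fin N → Fin 2) (Fin N → Fin 2) ℂ)
    (hρ : ρ.PosSemidef) (htr : ρ.trace = 1)
    (a : Fin N → Fin 2 → Fin 3 → ℝ) (ha : ∀ i x, ∑ t, a i x t ^ 2 = 1)
    (hH : ((corrMat N ρ) * (corrMat N ρ)ᵀ).IsHermitian)
    (t₀ t₁ : ℝ) (i j : Fin ((N + 1) / 2) → Fin 3) (hij : i ≠ j)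
    (ht₀ : t₀ = hH.eigenvalues i) (ht₁ : t₁ = hH.eigenvalues j)
    (hmax : ∀ k, hH.eigenvalues k ≤ t₀)
    (hsec : ∀ k, k ≠ i → hH.eigenvalues k ≤ t₁) :
    (Matrix.trace (MABK N (fun i x => obs (a i x)) * ρ)).re
      ≤ 2 * Real.sqrt (t₀ + t₁) := by
  obtain ⟨u, v, u', v', hu, hv, hu', hv', e⟩ := bip N ((N + 1) / 2) (N / 2) (by omega) hN ρ a ha
    (corrMat N ρ) (fun r c => rfl)
  rw [e]
  exact final (corrMat N ρ) hH t₀ t₁ i j ht₀ ht₁ hmax hsec u v u' v' hu hv hu' hv'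
end

section
/- Let ρ be a 3-qubit density matrix (positive-semidefinite complex 8×8 matrix of trace 1), and let a₀, a₁, b₀, b₁, c₀, c₁ ∈ ℝ³ be unit vectors defining observables A_x = a_x·σ⃗, B_y = b_y·σ⃗, C_z = c_z·σ⃗. Let M₃ = A₀⊗B₀⊗C₁ + A₀⊗B₁⊗C₀ + A₁⊗B₀⊗C₀ − A₁⊗B₁⊗C₁, let T_ρ be the 9×3 correlation matrix of ρ, and let t₀, t₁ be the largest and second-largest eigenvalues of the real symmetric matrix T_ρ·T_ρᵀ. Then Tr[M₃ ρ] ≤ 2√(t₀ + t₁). -/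
open BigOperators Matrix Kronecker
open scoped ComplexOrder

/-- The tripartite MABK operator
`M₃ = A₀⊗B₀⊗C₁ + A₀⊗B₁⊗C₀ + A₁⊗B₀⊗C₀ − A₁⊗B₁⊗C₁` (Kronecker products). -/
noncomputable def mabk3 (A₀ A₁ B₀ B₁ C₀ C₁ : Matrix (Fin 2) (Fin 2) ℂ) :
    Matrix ((Fin 2 × Fin 2) × Fin 2) ((Fin 2 × Fin 2) × Fin 2) ℂ :=
  A₀ ⊗ₖ B₀ ⊗ₖ C₁ + A₀ ⊗ₖ B₁ ⊗ₖ C₀ + A₁ ⊗ₖ B₀ ⊗ₖ C₀ - A₁ ⊗ₖ B₁ ⊗ₖ C₁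

/-- The 9×3 correlation matrix of a 3-qubit state, with entries
`Tr[ρ · σ_{ν₁}⊗σ_{ν₂}⊗σ_{ν₃}]` (real, since the traced operators are Hermitian). -/
noncomputable def corr3
    (ρ : Matrix ((Fin 2 × Fin 2) × Fin 2) ((Fin 2 × Fin 2) × Fin 2) ℂ) :
    Matrix (Fin 3 × Fin 3) (Fin 3) ℝ :=
  fun p ν₃ => (Matrix.trace (ρ * (pauli p.1 ⊗ₖ pauli p.2 ⊗ₖ pauli ν₃))).re

/-- Trilinear expansion of a product correlator. -/
lemma trace_obs (ρ : Matrix ((Fin 2 × Fin 2) × Fin 2) ((Fin 2 × Fin 2) × Fin 2) ℂ)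
    (a b c : Fin 3 → ℝ) :
    (Matrix.trace ((obs a ⊗ₖ obs b ⊗ₖ obs c) * ρ)).re
      = ∑ p : Fin 3 × Fin 3, (a p.1 * b p.2) * (corr3 ρ *ᵥ c) p := by
  rw [Matrix.trace_mul_comm]
  simp only [obs, corr3, Matrix.mulVec, dotProduct, Fintype.sum_prod_type, Fin.sum_univ_three,
    Matrix.add_kronecker, Matrix.kronecker_add, Matrix.smul_kronecker, Matrix.kronecker_smul,
    Matrix.mul_add, Matrix.mul_smul, Matrix.trace_add, Matrix.trace_smul, smul_eq_mul,
    Complex.add_re, Complex.re_ofReal_mul, smul_add]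
  ring

/-- Spectral expansion of the quadratic form. -/
lemma quad_eq {n : Type*} [Fintype n] [DecidableEq n] {A : Matrix n n ℝ} (hA : A.IsHermitian)
    (u : n → ℝ) :
    u ⬝ᵥ (A *ᵥ u) = ∑ k, hA.eigenvalues k * ((hA.eigenvectorBasis k : n → ℝ) ⬝ᵥ u) ^ 2 := by
  have h := hA.eigenvectorBasis.sum_inner_mul_inner (WithLp.toLp 2 u) (WithLp.toLp 2 (A *ᵥ u))
  simp only [EuclideanSpace.inner_eq_star_dotProduct, star_trivial] at h
  rw [dotProduct_comm, ← h]
  refine Finset.sum_congr rfl fun k _ => ?_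
  have h2 : (A *ᵥ u) ⬝ᵥ (hA.eigenvectorBasis k : n → ℝ)
      = hA.eigenvalues k * ((hA.eigenvectorBasis k : n → ℝ) ⬝ᵥ u) := by
    have h3 : Aᵀ = A := by simpa [Matrix.IsHermitian, conjTranspose_eq_transpose_of_trivial] using hA
    rw [dotProduct_comm, Matrix.dotProduct_mulVec, ← Matrix.mulVec_transpose, h3,
      hA.mulVec_eigenvectorBasis, smul_dotProduct, smul_eq_mul]
  rw [h2]
  ring

lemma norm_eq {n : Type*} [Fintype n] [DecidableEq n] {A : Matrix n n ℝ} (hA : A.IsHermitian)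
    (u : n → ℝ) :
    u ⬝ᵥ u = ∑ k, ((hA.eigenvectorBasis k : n → ℝ) ⬝ᵥ u) ^ 2 := by
  have h := hA.eigenvectorBasis.sum_inner_mul_inner (WithLp.toLp 2 u) (WithLp.toLp 2 u)
  simp only [EuclideanSpace.inner_eq_star_dotProduct, star_trivial] at h
  rw [← h]
  refine Finset.sum_congr rfl fun k _ => ?_
  rw [dotProduct_comm u]
  ring

lemma dot_self_nonneg {n : Type*} [Fintype n] (u : n → ℝ) : 0 ≤ u ⬝ᵥ u :=
  Finset.sum_nonneg fun i _ => mul_self_nonneg (u i)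

/-- Two-vector Bessel inequality, without normalization. -/
lemma bessel {n : Type*} [Fintype n] (u w v : n → ℝ) (hv : v ⬝ᵥ v = 1) (huw : u ⬝ᵥ w = 0)
    (hu : 0 < u ⬝ᵥ u) (hw : 0 < w ⬝ᵥ w) :
    (v ⬝ᵥ u) ^ 2 / (u ⬝ᵥ u) + (v ⬝ᵥ w) ^ 2 / (w ⬝ᵥ w) ≤ 1 := by
  have h := dot_self_nonneg (v - ((v ⬝ᵥ u) / (u ⬝ᵥ u)) • u - ((v ⬝ᵥ w) / (w ⬝ᵥ w)) • w)
  simp only [sub_dotProduct, dotProduct_sub, smul_dotProduct, dotProduct_smul, smul_eq_mul,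
    hv, huw, dotProduct_comm w u, dotProduct_comm u v, dotProduct_comm w v] at h
  have e1 : (v ⬝ᵥ u) / (u ⬝ᵥ u) * (u ⬝ᵥ u) = v ⬝ᵥ u := by field_simp
  have e2 : (v ⬝ᵥ w) / (w ⬝ᵥ w) * (w ⬝ᵥ w) = v ⬝ᵥ w := by field_simp
  rw [e1, e2] at h
  have e3 : (v ⬝ᵥ u) ^ 2 / (u ⬝ᵥ u) = (v ⬝ᵥ u) / (u ⬝ᵥ u) * (v ⬝ᵥ u) := by ring
  have e4 : (v ⬝ᵥ w) ^ 2 / (w ⬝ᵥ w) = (v ⬝ᵥ w) / (w ⬝ᵥ w) * (v ⬝ᵥ w) := by ring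
  rw [e3, e4]
  linarith

lemma quad_le {n : Type*} [Fintype n] [DecidableEq n] {A : Matrix n n ℝ} (hA : A.IsHermitian)
    (i : n) (t₁ : ℝ) (hsec : ∀ k, k ≠ i → hA.eigenvalues k ≤ t₁) (u : n → ℝ) :
    u ⬝ᵥ (A *ᵥ u) ≤ t₁ * (u ⬝ᵥ u)
      + (hA.eigenvalues i - t₁) * ((hA.eigenvectorBasis i : n → ℝ) ⬝ᵥ u) ^ 2 := by
  rw [quad_eq hA, norm_eq hA, ← Finset.add_sum_erase _ _ (Finset.mem_univ i),
    ← Finset.add_sum_erase (a := i) _ (fun k => ((hA.eigenvectorBasis k : n → ℝ) ⬝ᵥ u) ^ 2)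
      (Finset.mem_univ i), mul_add, Finset.mul_sum]
  have : ∑ k ∈ Finset.univ.erase i,
      hA.eigenvalues k * ((hA.eigenvectorBasis k : n → ℝ) ⬝ᵥ u) ^ 2
      ≤ ∑ k ∈ Finset.univ.erase i, t₁ * ((hA.eigenvectorBasis k : n → ℝ) ⬝ᵥ u) ^ 2 :=
    Finset.sum_le_sum fun k hk =>
      mul_le_mul_of_nonneg_right (hsec k (Finset.ne_of_mem_erase hk)) (sq_nonneg _)
  linarith

lemma cauchy {n : Type*} [Fintype n] (u c : n → ℝ) (hc : c ⬝ᵥ c = 1) :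
    u ⬝ᵥ c ≤ √(u ⬝ᵥ u) := by
  apply Real.le_sqrt_of_sq_le
  have h := dot_self_nonneg (u - (u ⬝ᵥ c) • c)
  simp only [sub_dotProduct, dotProduct_sub, smul_dotProduct, dotProduct_smul, smul_eq_mul,
    hc, dotProduct_comm c u] at h
  nlinarith

/-- Final scalar estimate in the non-degenerate case. -/
lemma scalar_le (x y n m s : ℝ) (hx : 0 ≤ x) (hy : 0 ≤ y) (hn : 0 < n) (hm : 0 < m)
    (hnm : n + m = 4) (h : x / n + y / m ≤ s) : √x + √y ≤ 2 * √s := by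
  have hs : 0 ≤ s := le_trans (by positivity) h
  refine (pow_le_pow_iff_left₀ (by positivity) (by positivity) two_ne_zero).1 ?_
  rw [mul_pow, Real.sq_sqrt hs]
  set p := √x / n
  set q := √y / m
  have ex : √x = p * n := by simp only [p]; field_simp
  have ey : √y = q * m := by simp only [q]; field_simp
  have hx2 : x / n = p ^ 2 * n := by
    rw [← Real.sq_sqrt hx, ex]; field_simp
  have hy2 : y / m = q ^ 2 * m := by
    rw [← Real.sq_sqrt hy, ey]; field_simp
  rw [hx2, hy2] at h
  rw [ex, ey]
  have : (p * n + q * m) ^ 2 ≤ (n + m) * (p ^ 2 * n + q ^ 2 * m) := by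
    nlinarith [mul_nonneg (mul_nonneg hn.le hm.le) (sq_nonneg (p - q))]
  rw [hnm] at this
  linarith

/-- for a 3-qubit density matrix `ρ` and rank-one projective observables
`A_x = a_x·σ⃗`, `B_y = b_y·σ⃗`, `C_z = c_z·σ⃗` given by unit vectors in ℝ³, the MABK
expectation satisfies `Tr[M₃ρ] ≤ 2√(t₀+t₁)`, where `t₀, t₁` are the largest and
second-largest eigenvalues (with multiplicity) of the real symmetric matrix
`T_ρ·T_ρᵀ` built from the 9×3 correlation matrix `T_ρ` of `ρ`. -/
theorem stmt3 (ρ : Matrix ((Fin 2 × Fin 2) × Fin 2) ((Fin 2 × Fin 2) × Fin 2) ℂ)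
    (hρ : ρ.PosSemidef) (htr : ρ.trace = 1)
    (hH : ((corr3 ρ) * (corr3 ρ)ᵀ).IsHermitian)
    (t₀ t₁ : ℝ) (i j : Fin 3 × Fin 3) (hij : i ≠ j)
    (ht₀ : t₀ = hH.eigenvalues i) (ht₁ : t₁ = hH.eigenvalues j)
    (hmax : ∀ k, hH.eigenvalues k ≤ t₀)
    (hsec : ∀ k, k ≠ i → hH.eigenvalues k ≤ t₁)
    (a₀ a₁ b₀ b₁ c₀ c₁ : Fin 3 → ℝ)
    (ha₀ : ∑ t, a₀ t ^ 2 = 1) (ha₁ : ∑ t, a₁ t ^ 2 = 1)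
    (hb₀ : ∑ t, b₀ t ^ 2 = 1) (hb₁ : ∑ t, b₁ t ^ 2 = 1)
    (hc₀ : ∑ t, c₀ t ^ 2 = 1) (hc₁ : ∑ t, c₁ t ^ 2 = 1) :
    (Matrix.trace
        (mabk3 (obs a₀) (obs a₁) (obs b₀) (obs b₁) (obs c₀) (obs c₁) * ρ)).re
      ≤ 2 * Real.sqrt (t₀ + t₁) := by
  have hPSD : ∀ u : Fin 3 × Fin 3 → ℝ, u ⬝ᵥ ((corr3 ρ * (corr3 ρ)ᵀ) *ᵥ u)
      = (u ᵥ* corr3 ρ) ⬝ᵥ (u ᵥ* corr3 ρ) := by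
    intro u
    rw [← Matrix.mulVec_mulVec, Matrix.dotProduct_mulVec, Matrix.mulVec_transpose]
  set T := corr3 ρ with hT
  set u : Fin 3 × Fin 3 → ℝ := fun p => a₀ p.1 * b₁ p.2 + a₁ p.1 * b₀ p.2 with hu
  set w : Fin 3 × Fin 3 → ℝ := fun p => a₀ p.1 * b₀ p.2 - a₁ p.1 * b₁ p.2 with hw
  have htrace : (Matrix.trace
      (mabk3 (obs a₀) (obs a₁) (obs b₀) (obs b₁) (obs c₀) (obs c₁) * ρ)).re
      = (u ᵥ* T) ⬝ᵥ c₀ + (w ᵥ* T) ⬝ᵥ c₁ := by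
    simp only [mabk3, Matrix.add_mul, Matrix.sub_mul, Matrix.trace_add, Matrix.trace_sub,
      Complex.add_re, Complex.sub_re, trace_obs, ← Matrix.dotProduct_mulVec]
    simp only [dotProduct, ← hT, hu, hw, ← Finset.sum_add_distrib, ← Finset.sum_sub_distrib]
    refine Finset.sum_congr rfl fun p _ => ?_
    ring
  simp only [Fin.sum_univ_three] at ha₀ ha₁ hb₀ hb₁
  have hc0 : c₀ ⬝ᵥ c₀ = 1 := by rw [← hc₀]; simp only [dotProduct, sq]
  have hc1 : c₁ ⬝ᵥ c₁ = 1 := by rw [← hc₁]; simp only [dotProduct, sq]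
  have huw : u ⬝ᵥ w = 0 := by
    simp only [dotProduct, hu, hw, Fintype.sum_prod_type, Fin.sum_univ_three]
    linear_combination (b₀ 0 * b₁ 0 + b₀ 1 * b₁ 1 + b₀ 2 * b₁ 2) * (ha₀ - ha₁)
      + (a₀ 0 * a₁ 0 + a₀ 1 * a₁ 1 + a₀ 2 * a₁ 2) * (hb₀ - hb₁)
  have hsum : u ⬝ᵥ u + w ⬝ᵥ w = 4 := by
    simp only [dotProduct, hu, hw, Fintype.sum_prod_type, Fin.sum_univ_three]
    linear_combination (b₀ 0 ^ 2 + b₀ 1 ^ 2 + b₀ 2 ^ 2 + b₁ 0 ^ 2 + b₁ 1 ^ 2 + b₁ 2 ^ 2)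
      * (ha₀ + ha₁) + 2 * (hb₀ + hb₁)
  have hv : ∀ k, (hH.eigenvectorBasis k : Fin 3 × Fin 3 → ℝ) ⬝ᵥ (hH.eigenvectorBasis k : Fin 3 × Fin 3 → ℝ) = 1 := by
    intro k
    have h := (orthonormal_iff_ite.1 hH.eigenvectorBasis.orthonormal) k k
    rw [EuclideanSpace.inner_eq_star_dotProduct, star_trivial, if_pos rfl] at h
    exact h
  have ht1 : 0 ≤ t₁ := by
    have h := hPSD (hH.eigenvectorBasis j)
    rw [hH.mulVec_eigenvectorBasis, dotProduct_smul, hv, smul_eq_mul, mul_one, ← ht₁] at h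
    rw [h]; exact dot_self_nonneg _
  have ht01 : t₁ ≤ t₀ := ht₁ ▸ hmax j
  have hQ := quad_le hH i t₁ hsec
  rw [← ht₀] at hQ
  have hQ0 : ∀ z : Fin 3 × Fin 3 → ℝ, z ⬝ᵥ z = 4 → √((z ᵥ* T) ⬝ᵥ (z ᵥ* T)) ≤ 2 * √(t₀ + t₁) := by
    intro z hz
    have h : (z ᵥ* T) ⬝ᵥ (z ᵥ* T) ≤ 2 ^ 2 * (t₀ + t₁) := by
      rw [← hPSD, quad_eq hH]
      have : ∑ k, hH.eigenvalues k * ((hH.eigenvectorBasis k : Fin 3 × Fin 3 → ℝ) ⬝ᵥ z) ^ 2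
          ≤ ∑ k, t₀ * ((hH.eigenvectorBasis k : Fin 3 × Fin 3 → ℝ) ⬝ᵥ z) ^ 2 :=
        Finset.sum_le_sum fun k _ => mul_le_mul_of_nonneg_right (hmax k) (sq_nonneg _)
      rw [← Finset.mul_sum, ← norm_eq hH, hz] at this
      linarith
    refine (Real.sqrt_le_sqrt h).trans ?_
    rw [Real.sqrt_mul (by norm_num), Real.sqrt_sq (by norm_num)]
  rw [htrace]
  refine (add_le_add (cauchy _ _ hc0) (cauchy _ _ hc1)).trans ?_
  rcases (dot_self_nonneg u).eq_or_lt with hu0 | hupos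
  · have hz : u = 0 := dotProduct_self_eq_zero.1 hu0.symm
    have h4 : w ⬝ᵥ w = 4 := by linarith
    have h := hQ0 w h4
    rw [hz, Matrix.zero_vecMul, dotProduct_zero, Real.sqrt_zero, zero_add]
    exact h
  rcases (dot_self_nonneg w).eq_or_lt with hw0 | hwpos
  · have hz : w = 0 := dotProduct_self_eq_zero.1 hw0.symm
    have h4 : u ⬝ᵥ u = 4 := by linarith
    have h := hQ0 u h4
    rw [hz, Matrix.zero_vecMul, dotProduct_zero, Real.sqrt_zero, add_zero]
    exact h
  refine scalar_le _ _ _ _ _ (dot_self_nonneg _) (dot_self_nonneg _) hupos hwpos hsum ?_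
  have hB := bessel u w _ (hv i) huw hupos hwpos
  have h1 := div_le_div_of_nonneg_right (hQ u) hupos.le
  have h2 := div_le_div_of_nonneg_right (hQ w) hwpos.le
  rw [hPSD, add_div, mul_div_assoc, div_self hupos.ne', mul_one, mul_div_assoc] at h1
  rw [hPSD, add_div, mul_div_assoc, div_self hwpos.ne', mul_one, mul_div_assoc] at h2
  have h3 := mul_le_mul_of_nonneg_left hB (sub_nonneg.2 ht01)
  rw [mul_add] at h3
  linarith
end

section
/- Let λ_{ijk} ≥ 0 (i,j,k ∈ {0,1}) and s ∈ ℝ, and let ρ be the 3-qubit state whose matrix in the GHZ basis is diagonal with entries λ_{ijk} except for off-diagonal entries ⟨ψ_{0,1,1}|ρ|ψ_{1,1,1}⟩ = i·s and ⟨ψ_{1,1,1}|ρ|ψ_{0,1,1}⟩ = −i·s, normalized so that Tr ρ = 1. Define ρ_{ijk} = λ_{ijk} for (j,k) ≠ (1,1) and ρ_{i11} = (λ_{011} + λ_{111} + (−1)^i √((λ_{011} − λ_{111})² + 4s²))/2 (these are the eigenvalues of ρ). Then for every choice of unit vectors a₀, a₁, b₀, b₁, c₀, c₁ ∈ ℝ³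 defining rank-one projective observables A_x = a_x·σ⃗, B_y = b_y·σ⃗, C_z = c_z·σ⃗, the MABK expectation satisfies Tr[M₃ ρ] ≤ 4√( Σ_{j,k∈{0,1}} (ρ_{0jk} − ρ_{1jk})² ). -/
open BigOperators Matrix Kronecker

/-- The GHZ-basis state `|ψ_{i,j,k}⟩ = (|0,j,k⟩ + (−1)^i |1,j̄,k̄⟩)/√2` of ℂ⁸
(indexed by `(Fin 2 × Fin 2) × Fin 2`). -/
noncomputable def ghz (i j k : Fin 2) : ((Fin 2 × Fin 2) × Fin 2) → ℂ :=
  fun v =>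
    (if v = ((0, j), k) then (((Real.sqrt 2)⁻¹ : ℝ) : ℂ) else 0)
      + (if v = ((1, 1 - j), 1 - k) then
          (-1 : ℂ) ^ (i : ℕ) * (((Real.sqrt 2)⁻¹ : ℝ) : ℂ) else 0)

/-- The rank-one operator `|u⟩⟨v|`. -/
noncomputable def outer (u v : ((Fin 2 × Fin 2) × Fin 2) → ℂ) :
    Matrix ((Fin 2 × Fin 2) × Fin 2) ((Fin 2 × Fin 2) × Fin 2) ℂ :=
  fun r c => u r * (starRingEnd ℂ) (v c)

lemma obs_entries (a : Fin 3 → ℝ) :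
    obs a = !![(a 2 : ℂ), a 0 - Complex.I * a 1; a 0 + Complex.I * a 1, -(a 2 : ℂ)] := by
  ext i j
  fin_cases i <;> fin_cases j <;>
    simp [obs, pauli, Fin.sum_univ_three] <;> ring

lemma trace_outer (M : Matrix ((Fin 2 × Fin 2) × Fin 2) ((Fin 2 × Fin 2) × Fin 2) ℂ)
    (i i' j k : Fin 2) :
    Matrix.trace (M * outer (ghz i j k) (ghz i' j k)) =
      (1 / 2) * (M ((0, j), k) ((0, j), k)
        + (-1) ^ (i' : ℕ) * M ((1, 1 - j), 1 - k) ((0, j), k)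
        + (-1) ^ (i : ℕ) * M ((0, j), k) ((1, 1 - j), 1 - k)
        + (-1) ^ (i : ℕ) * (-1) ^ (i' : ℕ) *
          M ((1, 1 - j), 1 - k) ((1, 1 - j), 1 - k)) := by
  have h2 : (((Real.sqrt 2)⁻¹ : ℝ) : ℂ) * (((Real.sqrt 2)⁻¹ : ℝ) : ℂ) = 1 / 2 := by
    rw [← Complex.ofReal_mul, ← mul_inv, Real.mul_self_sqrt (by norm_num)]
    norm_num
  have hu : ∀ (f : (Fin 2 × Fin 2) × Fin 2 → ℂ) (i : Fin 2), ∑ c, f c * ghz i j k c =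
      (((Real.sqrt 2)⁻¹ : ℝ) : ℂ) * (f ((0, j), k) + (-1) ^ (i : ℕ) * f ((1, 1 - j), 1 - k)) := by
    intro f i
    simp only [ghz, mul_add, Finset.sum_add_distrib, mul_ite, mul_zero, Finset.sum_ite_eq',
      Finset.mem_univ, if_true]
    ring
  have hc : ∀ (i : Fin 2) (r : (Fin 2 × Fin 2) × Fin 2),
      (starRingEnd ℂ) (ghz i j k r) = ghz i j k r := by
    intro i r
    simp only [ghz, map_add, apply_ite (starRingEnd ℂ), map_mul, map_pow, map_neg, map_one,
      map_zero, Complex.conj_ofReal]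
  simp only [Matrix.trace, Matrix.diag, Matrix.mul_apply, outer, hc, ← mul_assoc,
    ← Finset.sum_mul]
  rw [hu, hu, hu, ← h2]
  ring

/-- A linear function bounded at the vertices of the polytope `|a| ≤ (A₀+A₁)/2`, `Aᵢ ∈ [0,1]`. -/
lemma lin_bound (p q r A₀ A₁ a : ℝ) (h0 : 0 ≤ A₀) (h0' : A₀ ≤ 1) (h1 : 0 ≤ A₁) (h1' : A₁ ≤ 1)
    (ha : |a| ≤ (A₀ + A₁) / 2)
    (e1 : p + r / 2 ≤ 4) (e2 : p - r / 2 ≤ 4) (e3 : q + r / 2 ≤ 4) (e4 : q - r / 2 ≤ 4)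
    (e5 : p + q + r ≤ 4) (e6 : p + q - r ≤ 4) : p * A₀ + q * A₁ + r * a ≤ 4 := by
  have key : ∀ P Q : ℝ, P ≤ 4 → Q ≤ 4 → P + Q ≤ 4 → P * A₀ + Q * A₁ ≤ 4 := by
    intro P Q hP hQ hPQ
    rcases le_total A₀ A₁ with h | h
    · nlinarith [mul_nonneg h0 (sub_nonneg.2 hPQ), mul_nonneg (sub_nonneg.2 h) (sub_nonneg.2 hQ)]
    · nlinarith [mul_nonneg h1 (sub_nonneg.2 hPQ), mul_nonneg (sub_nonneg.2 h) (sub_nonneg.2 hP)]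
  obtain ⟨l, u⟩ := abs_le.1 ha
  rcases le_total 0 r with hr | hr
  · have := key (p + r / 2) (q + r / 2) e1 e3 (by linarith)
    nlinarith [mul_nonneg hr (sub_nonneg.2 u)]
  · have := key (p - r / 2) (q - r / 2) e2 e4 (by linarith)
    nlinarith [mul_nonneg (neg_nonneg.2 hr) (sub_nonneg.2 l)]

lemma tri_bound (A₀ A₁ a B₀ B₁ b C₀ C₁ c : ℝ)
    (hA0 : 0 ≤ A₀) (hA0' : A₀ ≤ 1) (hA1 : 0 ≤ A₁) (hA1' : A₁ ≤ 1) (ha : |a| ≤ (A₀ + A₁) / 2)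
    (hB0 : 0 ≤ B₀) (hB0' : B₀ ≤ 1) (hB1 : 0 ≤ B₁) (hB1' : B₁ ≤ 1) (hb : |b| ≤ (B₀ + B₁) / 2)
    (hC0 : 0 ≤ C₀) (hC0' : C₀ ≤ 1) (hC1 : 0 ≤ C₁) (hC1' : C₁ ≤ 1) (hc : |c| ≤ (C₀ + C₁) / 2) :
    A₀ * B₀ * C₁ + A₀ * B₁ * C₀ + A₁ * B₀ * C₀ + A₁ * B₁ * C₁
      + 2 * b * c * (A₀ - A₁) + 2 * a * c * (B₀ - B₁) + 2 * a * b * (C₀ - C₁) ≤ 4 := by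
  have g : ∀ A₀ A₁ a B₀ B₁ b, 
      (∀ C₀ C₁ c : ℝ, (C₀, C₁, c) ∈ ({(1,0,1/2),(1,0,-1/2),(0,1,1/2),(0,1,-1/2),(1,1,1),(1,1,-1)} : Set (ℝ × ℝ × ℝ)) →
      A₀ * B₀ * C₁ + A₀ * B₁ * C₀ + A₁ * B₀ * C₀ + A₁ * B₁ * C₁
      + 2 * b * c * (A₀ - A₁) + 2 * a * c * (B₀ - B₁) + 2 * a * b * (C₀ - C₁) ≤ 4) → 
      A₀ * B₀ * C₁ + A₀ * B₁ * C₀ + A₁ * B₀ * C₀ + A₁ * B₁ * C₁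
      + 2 * b * c * (A₀ - A₁) + 2 * a * c * (B₀ - B₁) + 2 * a * b * (C₀ - C₁) ≤ 4 := by
    intro A₀ A₁ a B₀ B₁ b h
    have h1 := h 1 0 (1/2) (by simp)
    have h2 := h 1 0 (-1/2) (by simp)
    have h3 := h 0 1 (1/2) (by simp)
    have h4 := h 0 1 (-1/2) (by simp)
    have h5 := h 1 1 1 (by simp)
    have h6 := h 1 1 (-1) (by simp)
    have := lin_bound (A₀ * B₁ + A₁ * B₀ + 2 * a * b) (A₀ * B₀ + A₁ * B₁ - 2 * a * b)
      (2 * b * (A₀ - A₁) + 2 * a * (B₀ - B₁)) C₀ C₁ c hC0 hC0' hC1 hC1' hc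
      (by linarith) (by linarith) (by linarith) (by linarith) (by linarith) (by linarith)
    linarith
  apply g
  intro C₀ C₁ c hC
  have g2 : ∀ A₀ A₁ a,
      (∀ B₀ B₁ b : ℝ, (B₀, B₁, b) ∈ ({(1,0,1/2),(1,0,-1/2),(0,1,1/2),(0,1,-1/2),(1,1,1),(1,1,-1)} : Set (ℝ × ℝ × ℝ)) →
      A₀ * B₀ * C₁ + A₀ * B₁ * C₀ + A₁ * B₀ * C₀ + A₁ * B₁ * C₁
      + 2 * b * c * (A₀ - A₁) + 2 * a * c * (B₀ - B₁) + 2 * a * b * (C₀ - C₁) ≤ 4) → 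
      A₀ * B₀ * C₁ + A₀ * B₁ * C₀ + A₁ * B₀ * C₀ + A₁ * B₁ * C₁
      + 2 * b * c * (A₀ - A₁) + 2 * a * c * (B₀ - B₁) + 2 * a * b * (C₀ - C₁) ≤ 4 := by
    intro A₀ A₁ a h
    have h1 := h 1 0 (1/2) (by simp)
    have h2 := h 1 0 (-1/2) (by simp)
    have h3 := h 0 1 (1/2) (by simp)
    have h4 := h 0 1 (-1/2) (by simp)
    have h5 := h 1 1 1 (by simp)
    have h6 := h 1 1 (-1) (by simp)
    have := lin_bound (A₀ * C₁ + A₁ * C₀ + 2 * a * c) (A₀ * C₀ + A₁ * C₁ - 2 * a * c)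
      (2 * c * (A₀ - A₁) + 2 * a * (C₀ - C₁)) B₀ B₁ b hB0 hB0' hB1 hB1' hb
      (by linarith) (by linarith) (by linarith) (by linarith) (by linarith) (by linarith)
    linarith
  apply g2
  intro B₀ B₁ b hB
  have := lin_bound (B₀ * C₁ + B₁ * C₀ + 2 * b * c) (B₀ * C₀ + B₁ * C₁ - 2 * b * c)
      (2 * c * (B₀ - B₁) + 2 * b * (C₀ - C₁)) A₀ A₁ a hA0 hA0' hA1 hA1' ha
  simp only [Set.mem_insert_iff, Set.mem_singleton_iff, Prod.mk.injEq] at hB hC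
  suffices (B₀ * C₁ + B₁ * C₀ + 2 * b * c) * A₀ + (B₀ * C₀ + B₁ * C₁ - 2 * b * c) * A₁ +
      (2 * c * (B₀ - B₁) + 2 * b * (C₀ - C₁)) * a ≤ 4 by linarith
  rcases hB with ⟨rfl, rfl, rfl⟩ | ⟨rfl, rfl, rfl⟩ | ⟨rfl, rfl, rfl⟩ | ⟨rfl, rfl, rfl⟩ |
    ⟨rfl, rfl, rfl⟩ | ⟨rfl, rfl, rfl⟩ <;>
  rcases hC with ⟨rfl, rfl, rfl⟩ | ⟨rfl, rfl, rfl⟩ | ⟨rfl, rfl, rfl⟩ | ⟨rfl, rfl, rfl⟩ |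
    ⟨rfl, rfl, rfl⟩ | ⟨rfl, rfl, rfl⟩ <;>
  apply this <;> norm_num

/-- Real part of the MABK form at complex numbers `(x, y)`. -/
def mre (p₀ q₀ p₁ q₁ u₀ v₀ u₁ v₁ x₀ y₀ x₁ y₁ : ℝ) : ℝ :=
  (p₀ * u₀ - q₀ * v₀) * x₁ - (p₀ * v₀ + q₀ * u₀) * y₁
  + ((p₀ * u₁ - q₀ * v₁) * x₀ - (p₀ * v₁ + q₀ * u₁) * y₀)
  + ((p₁ * u₀ - q₁ * v₀) * x₀ - (p₁ * v₀ + q₁ * u₀) * y₀)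
  - ((p₁ * u₁ - q₁ * v₁) * x₁ - (p₁ * v₁ + q₁ * u₁) * y₁)

/-- Imaginary part of the MABK form at complex numbers `(x, y)`. -/
def mim (p₀ q₀ p₁ q₁ u₀ v₀ u₁ v₁ x₀ y₀ x₁ y₁ : ℝ) : ℝ :=
  (p₀ * u₀ - q₀ * v₀) * y₁ + (p₀ * v₀ + q₀ * u₀) * x₁
  + ((p₀ * u₁ - q₀ * v₁) * y₀ + (p₀ * v₁ + q₀ * u₁) * x₀)
  + ((p₁ * u₀ - q₁ * v₀) * y₀ + (p₁ * v₀ + q₁ * u₀) * x₀)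
  - ((p₁ * u₁ - q₁ * v₁) * y₁ + (p₁ * v₁ + q₁ * u₁) * x₁)

lemma form_bound (p₀ q₀ p₁ q₁ u₀ v₀ u₁ v₁ x₀ y₀ x₁ y₁ : ℝ)
    (h1 : p₀ ^ 2 + q₀ ^ 2 ≤ 1) (h2 : p₁ ^ 2 + q₁ ^ 2 ≤ 1)
    (h3 : u₀ ^ 2 + v₀ ^ 2 ≤ 1) (h4 : u₁ ^ 2 + v₁ ^ 2 ≤ 1)
    (h5 : x₀ ^ 2 + y₀ ^ 2 ≤ 1) (h6 : x₁ ^ 2 + y₁ ^ 2 ≤ 1) :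
    mre p₀ q₀ p₁ q₁ u₀ v₀ u₁ v₁ x₀ y₀ x₁ y₁ ^ 2
    + mre p₀ q₀ p₁ q₁ u₀ v₀ u₁ v₁ x₀ (-y₀) x₁ (-y₁) ^ 2
    + mre p₀ q₀ p₁ q₁ u₀ (-v₀) u₁ (-v₁) x₀ y₀ x₁ y₁ ^ 2
    + mre p₀ q₀ p₁ q₁ u₀ (-v₀) u₁ (-v₁) x₀ (-y₀) x₁ (-y₁) ^ 2
    + mim p₀ q₀ p₁ q₁ u₀ (-v₀) u₁ (-v₁) x₀ (-y₀) x₁ (-y₁) ^ 2 ≤ 16 := by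
  have hab : ∀ x y z w : ℝ, |x * z + y * w| ≤ ((x ^ 2 + y ^ 2) + (z ^ 2 + w ^ 2)) / 2 := by
    intro x y z w
    rw [abs_le]
    constructor <;> nlinarith [sq_nonneg (x - z), sq_nonneg (y - w), sq_nonneg (x + z), sq_nonneg (y + w)]
  have T := tri_bound (p₀ ^ 2 + q₀ ^ 2) (p₁ ^ 2 + q₁ ^ 2) (p₀ * p₁ + q₀ * q₁)
    (u₀ ^ 2 + v₀ ^ 2) (u₁ ^ 2 + v₁ ^ 2) (u₀ * u₁ + v₀ * v₁)
    (x₀ ^ 2 + y₀ ^ 2) (x₁ ^ 2 + y₁ ^ 2) (x₀ * x₁ + y₀ * y₁)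
    (by positivity) h1 (by positivity) h2 (hab _ _ _ _)
    (by positivity) h3 (by positivity) h4 (hab _ _ _ _)
    (by positivity) h5 (by positivity) h6 (hab _ _ _ _)
  have e : ∀ P Q R W X Y Z V : ℝ, P + Q + R + W + V + (X + Y + Z) ≤ 16 → 0 ≤ X → 0 ≤ Y → 0 ≤ Z →
    P + Q + R + W + V ≤ 16 := by intros; linarith
  apply e _ _ _ _ (mim p₀ q₀ p₁ q₁ u₀ v₀ u₁ v₁ x₀ y₀ x₁ y₁ ^ 2)
    (mim p₀ q₀ p₁ q₁ u₀ v₀ u₁ v₁ x₀ (-y₀) x₁ (-y₁) ^ 2)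
    (mim p₀ q₀ p₁ q₁ u₀ (-v₀) u₁ (-v₁) x₀ y₀ x₁ y₁ ^ 2) _ _
    (sq_nonneg _) (sq_nonneg _) (sq_nonneg _)
  refine le_trans (le_of_eq ?_) ((mul_le_mul_of_nonneg_left T
    (by norm_num : (0 : ℝ) ≤ 4)).trans (by norm_num))
  simp only [mre, mim]
  ring

lemma cs5 (a b c d e x y z w v : ℝ) :
    (a * x + b * y + c * z + d * w + e * v) ^ 2 ≤
      (a ^ 2 + b ^ 2 + c ^ 2 + d ^ 2 + e ^ 2) * (x ^ 2 + y ^ 2 + z ^ 2 + w ^ 2 + v ^ 2) := by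
  have := Finset.sum_mul_sq_le_sq_mul_sq Finset.univ ![a, b, c, d, e] ![x, y, z, w, v]
  simpa [Fin.sum_univ_succ, add_assoc] using this

lemma sq_le_of_unit (a : Fin 3 → ℝ) (h : ∑ t, a t ^ 2 = 1) : a 0 ^ 2 + a 1 ^ 2 ≤ 1 := by
  rw [Fin.sum_univ_three] at h
  nlinarith [sq_nonneg (a 2)]

/-- let `ρ` be the 3-qubit state which, in the GHZ basis, is diagonal with
nonnegative entries `λ_{ijk}` except for the off-diagonal terms
`⟨ψ₀₁₁|ρ|ψ₁₁₁⟩ = i·s`, `⟨ψ₁₁₁|ρ|ψ₀₁₁⟩ = −i·s`, normalized to `Tr ρ = 1`. With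
`ρ_{ijk} = λ_{ijk}` for `(j,k) ≠ (1,1)` and
`ρ_{i11} = (λ_{011}+λ_{111}+(−1)^i √((λ_{011}−λ_{111})²+4s²))/2` (the eigenvalues),
every choice of unit vectors defining rank-one projective observables gives
`Tr[M₃ρ] ≤ 4√(Σ_{jk}(ρ_{0jk}−ρ_{1jk})²)`. -/
theorem stmt4 (lam : Fin 2 → Fin 2 → Fin 2 → ℝ) (s : ℝ)
    (hlam : ∀ i j k, 0 ≤ lam i j k)
    (ρ : Matrix ((Fin 2 × Fin 2) × Fin 2) ((Fin 2 × Fin 2) × Fin 2) ℂ)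
    (hρ : ρ = (∑ i, ∑ j, ∑ k, (lam i j k : ℂ) • outer (ghz i j k) (ghz i j k))
      + ((Complex.I * (s : ℂ)) •
          (outer (ghz 0 1 1) (ghz 1 1 1) - outer (ghz 1 1 1) (ghz 0 1 1))))
    (htr : ρ.trace = 1)
    (ev : Fin 2 → Fin 2 → Fin 2 → ℝ)
    (hev1 : ∀ i j k : Fin 2, (j, k) ≠ (1, 1) → ev i j k = lam i j k)
    (hev2 : ∀ i : Fin 2, ev i 1 1 = (lam 0 1 1 + lam 1 1 1
      + (-1 : ℝ) ^ (i : ℕ) * Real.sqrt ((lam 0 1 1 - lam 1 1 1) ^ 2 + 4 * s ^ 2)) / 2)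
    (a₀ a₁ b₀ b₁ c₀ c₁ : Fin 3 → ℝ)
    (ha₀ : ∑ t, a₀ t ^ 2 = 1) (ha₁ : ∑ t, a₁ t ^ 2 = 1)
    (hb₀ : ∑ t, b₀ t ^ 2 = 1) (hb₁ : ∑ t, b₁ t ^ 2 = 1)
    (hc₀ : ∑ t, c₀ t ^ 2 = 1) (hc₁ : ∑ t, c₁ t ^ 2 = 1) :
    (Matrix.trace
        (mabk3 (obs a₀) (obs a₁) (obs b₀) (obs b₁) (obs c₀) (obs c₁) * ρ)).re
      ≤ 4 * Real.sqrt (∑ j, ∑ k, (ev 0 j k - ev 1 j k) ^ 2) := by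
  have hre : (Matrix.trace
        (mabk3 (obs a₀) (obs a₁) (obs b₀) (obs b₁) (obs c₀) (obs c₁) * ρ)).re =
      (lam 0 0 0 - lam 1 0 0) * mre (a₀ 0) (a₀ 1) (a₁ 0) (a₁ 1) (b₀ 0) (b₀ 1) (b₁ 0) (b₁ 1)
        (c₀ 0) (c₀ 1) (c₁ 0) (c₁ 1)
      + (lam 0 0 1 - lam 1 0 1) * mre (a₀ 0) (a₀ 1) (a₁ 0) (a₁ 1) (b₀ 0) (b₀ 1) (b₁ 0) (b₁ 1)
        (c₀ 0) (-c₀ 1) (c₁ 0) (-c₁ 1)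
      + (lam 0 1 0 - lam 1 1 0) * mre (a₀ 0) (a₀ 1) (a₁ 0) (a₁ 1) (b₀ 0) (-b₀ 1) (b₁ 0) (-b₁ 1)
        (c₀ 0) (c₀ 1) (c₁ 0) (c₁ 1)
      + (lam 0 1 1 - lam 1 1 1) * mre (a₀ 0) (a₀ 1) (a₁ 0) (a₁ 1) (b₀ 0) (-b₀ 1) (b₁ 0) (-b₁ 1)
        (c₀ 0) (-c₀ 1) (c₁ 0) (-c₁ 1)
      + (2 * s) * mim (a₀ 0) (a₀ 1) (a₁ 0) (a₁ 1) (b₀ 0) (-b₀ 1) (b₁ 0) (-b₁ 1)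
        (c₀ 0) (-c₀ 1) (c₁ 0) (-c₁ 1) := by
    rw [hρ]
    simp only [Matrix.mul_add, Matrix.mul_sub, Matrix.mul_smul, Matrix.trace_add,
      Matrix.trace_sub, Matrix.trace_smul, trace_outer, Fin.sum_univ_two]
    simp [mabk3, obs_entries, mre, mim]
    ring
  rw [hre]
  have hS : ∑ j, ∑ k, (ev 0 j k - ev 1 j k) ^ 2 =
      (lam 0 0 0 - lam 1 0 0) ^ 2 + (lam 0 0 1 - lam 1 0 1) ^ 2 + (lam 0 1 0 - lam 1 1 0) ^ 2
        + (lam 0 1 1 - lam 1 1 1) ^ 2 + (2 * s) ^ 2 := by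
    have e : (ev 0 1 1 - ev 1 1 1) ^ 2 = (lam 0 1 1 - lam 1 1 1) ^ 2 + 4 * s ^ 2 := by
      rw [← Real.sq_sqrt (by positivity : 0 ≤ (lam 0 1 1 - lam 1 1 1) ^ 2 + 4 * s ^ 2), hev2, hev2]
      simp
      ring
    simp only [Fin.sum_univ_two]
    rw [e, hev1 0 0 0 (by simp), hev1 1 0 0 (by simp), hev1 0 0 1 (by simp), hev1 1 0 1 (by simp),
      hev1 0 1 0 (by simp), hev1 1 1 0 (by simp)]
    ring
  rw [hS]
  have hF := form_bound (a₀ 0) (a₀ 1) (a₁ 0) (a₁ 1) (b₀ 0) (b₀ 1) (b₁ 0) (b₁ 1)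
        (c₀ 0) (c₀ 1) (c₁ 0) (c₁ 1) (sq_le_of_unit _ ha₀) (sq_le_of_unit _ ha₁)
        (sq_le_of_unit _ hb₀) (sq_le_of_unit _ hb₁) (sq_le_of_unit _ hc₀) (sq_le_of_unit _ hc₁)
  refine le_trans (Real.le_sqrt_of_sq_le (le_trans (cs5 _ _ _ _ _ _ _ _ _ _)
    (mul_le_mul_of_nonneg_left hF (by positivity)))) (le_of_eq ?_)
  rw [Real.sqrt_mul (by positivity), show (16 : ℝ) = 4 ^ 2 by norm_num,
    Real.sqrt_sq (by norm_num), mul_comm]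
end

section
/- Let n ≥ 1 and for each i ∈ {1,…,n} let a^i₀, a^i₁ ∈ ℝ³ be unit vectors. For a bit string x ∈ {0,1}ⁿ let ω(x) denote its Hamming weight, and define the vectors v₀ = Σ_{x ∈ {0,1}ⁿ, ω(x) even} (−1)^{⌊ω(x)/2⌋} · a¹_{x₁}⊗a²_{x₂}⊗…⊗aⁿ_{xₙ} and v₁ = Σ_{x ∈ {0,1}ⁿ, ω(x) odd} (−1)^{⌊ω(x)/2⌋} · a¹_{x₁}⊗…⊗aⁿ_{xₙ} in ℝ^{3ⁿ} (iterated Kronecker products). Then ‖v₀‖² + ‖v₁‖² = 2ⁿ. -/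
open BigOperators Finset

lemma I_pow_re_im (w : ℕ) : (Complex.I ^ w).re = (if w % 2 = 0 then (-1 : ℝ) ^ (w / 2) else 0) ∧
    (Complex.I ^ w).im = (if w % 2 = 1 then (-1 : ℝ) ^ (w / 2) else 0) := by
  have key : ∀ k : ℕ, Complex.I ^ (2 * k) = (((-1 : ℝ) ^ k : ℝ) : ℂ) := by
    intro k
    rw [pow_mul, Complex.I_sq]
    push_cast
    rfl
  rcases Nat.mod_two_eq_zero_or_one w with h | h
  · have hw : w = 2 * (w / 2) := by omega
    have h2 : Complex.I ^ w = (((-1 : ℝ) ^ (w / 2) : ℝ) : ℂ) := by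
      rw [← key, ← hw]
    rw [h2, Complex.ofReal_re, Complex.ofReal_im]
    simp [h]
  · have hw : w = 2 * (w / 2) + 1 := by omega
    have h2 : Complex.I ^ w = (((-1 : ℝ) ^ (w / 2) : ℝ) : ℂ) * Complex.I := by
      rw [← key, ← pow_succ, ← hw]
    rw [h2, Complex.re_ofReal_mul, Complex.im_ofReal_mul]
    simp [h]

lemma sq_add_sq_eq_prod (n : ℕ) (b : Fin n → Fin 2 → ℝ) :
    (∑ x ∈ univ.filter (fun x : Fin n → Fin 2 => (∑ i, (x i : ℕ)) % 2 = 0),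
          (-1 : ℝ) ^ ((∑ i, (x i : ℕ)) / 2) * ∏ i, b i (x i)) ^ 2
      + (∑ x ∈ univ.filter (fun x : Fin n → Fin 2 => (∑ i, (x i : ℕ)) % 2 = 1),
          (-1 : ℝ) ^ ((∑ i, (x i : ℕ)) / 2) * ∏ i, b i (x i)) ^ 2
      = ∏ i, (b i 0 ^ 2 + b i 1 ^ 2) := by
  have hz : ∏ i, (∑ j : Fin 2, Complex.I ^ (j : ℕ) * (b i j : ℂ))
      = ∑ x : Fin n → Fin 2, Complex.I ^ (∑ i, (x i : ℕ)) * ((∏ i, b i (x i) : ℝ) : ℂ) := by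
    rw [Finset.prod_univ_sum, Fintype.piFinset_univ]
    refine Finset.sum_congr rfl fun x _ => ?_
    rw [Finset.prod_mul_distrib, Finset.prod_pow_eq_pow_sum, Complex.ofReal_prod]
  have hn := congrArg Complex.normSq hz
  rw [map_prod, Complex.normSq_apply (∑ x : Fin n → Fin 2, _), Complex.re_sum,
    Complex.im_sum] at hn
  simp only [Complex.re_mul_ofReal, Complex.im_mul_ofReal, (I_pow_re_im _).1,
    (I_pow_re_im _).2, ite_mul, zero_mul, ← Finset.sum_filter] at hn
  rw [sq, sq, ← hn]
  refine Finset.prod_congr rfl fun i _ => ?_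
  simp [Fin.sum_univ_two, Complex.normSq_apply]
  ring

/-- with `v₀` the signed sum of iterated Kronecker products over even-weight
bit strings and `v₁` over odd-weight bit strings, `‖v₀‖² + ‖v₁‖² = 2ⁿ`. Vectors in
`ℝ^(3ⁿ)` are indexed by `Fin n → Fin 3`, and the iterated Kronecker product of unit
vectors `a i (x i)` has entries `∏ i, a i (x i) (ν i)`. -/
theorem stmt7 (n : ℕ) (hn : 1 ≤ n) (a : Fin n → Fin 2 → Fin 3 → ℝ)
    (ha : ∀ i x, ∑ t, a i x t ^ 2 = 1) :
    (∑ ν : Fin n → Fin 3,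
        (∑ x ∈ univ.filter (fun x : Fin n → Fin 2 => (∑ i, (x i : ℕ)) % 2 = 0),
          (-1 : ℝ) ^ ((∑ i, (x i : ℕ)) / 2) * ∏ i, a i (x i) (ν i)) ^ 2)
      + (∑ ν : Fin n → Fin 3,
        (∑ x ∈ univ.filter (fun x : Fin n → Fin 2 => (∑ i, (x i : ℕ)) % 2 = 1),
          (-1 : ℝ) ^ ((∑ i, (x i : ℕ)) / 2) * ∏ i, a i (x i) (ν i)) ^ 2)
      = 2 ^ n := by
  rw [← Finset.sum_add_distrib,
    Finset.sum_congr rfl fun ν _ => sq_add_sq_eq_prod n (fun i x => a i x (ν i))]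
  have h := Finset.prod_univ_sum (fun _ : Fin n => (univ : Finset (Fin 3)))
    (fun i t => a i 0 t ^ 2 + a i 1 t ^ 2)
  rw [Fintype.piFinset_univ] at h
  rw [← h]
  simp only [Finset.sum_add_distrib, ha]
  norm_num
end

section
/- Let ρ_{ijk} ≥ 0 for i,j,k ∈ {0,1} satisfy Σ_{i,j,k} ρ_{ijk} = 1, suppose ρ_{0jk} ≥ ρ_{1jk} for all j,k, and suppose ρ_{000} is the largest of all eight values. Then Σ_{j,k ∈ {0,1}} (ρ_{0jk} − ρ_{1jk})² ≤ ρ_{000}. In particular, if 4·√( Σ_{j,k} (ρ_{0jk} − ρ_{1jk})² ) ≥ 2√2, then ρ_{000} ≥ 1/2. -/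
open BigOperators

/-- for eight nonnegative reals `ρ_{ijk}` summing to 1 with
`ρ_{0jk} ≥ ρ_{1jk}` and `ρ_{000}` the largest entry, one has
`Σ_{jk} (ρ_{0jk} − ρ_{1jk})² ≤ ρ_{000}`; in particular if
`4√(Σ_{jk}(ρ_{0jk}−ρ_{1jk})²) ≥ 2√2` then `ρ_{000} ≥ 1/2`. -/
theorem stmt11 (ρ : Fin 2 → Fin 2 → Fin 2 → ℝ)
    (hpos : ∀ i j k, 0 ≤ ρ i j k)
    (hsum : ∑ i, ∑ j, ∑ k, ρ i j k = 1)
    (hord : ∀ j k, ρ 1 j k ≤ ρ 0 j k)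
    (hmax : ∀ i j k, ρ i j k ≤ ρ 0 0 0) :
    (∑ j, ∑ k, (ρ 0 j k - ρ 1 j k) ^ 2) ≤ ρ 0 0 0 ∧
    (2 * Real.sqrt 2 ≤ 4 * Real.sqrt (∑ j, ∑ k, (ρ 0 j k - ρ 1 j k) ^ 2) →
      1 / 2 ≤ ρ 0 0 0) := by
  have key : ∀ j k, (ρ 0 j k - ρ 1 j k) ^ 2 ≤ ρ 0 0 0 * (ρ 0 j k + ρ 1 j k) := by
    intro j k
    have h1 : 0 ≤ ρ 0 j k - ρ 1 j k := sub_nonneg.2 (hord j k)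
    have h2 : ρ 0 j k - ρ 1 j k ≤ ρ 0 0 0 := by linarith [hmax 0 j k, hpos 1 j k]
    have h3 : ρ 0 j k - ρ 1 j k ≤ ρ 0 j k + ρ 1 j k := by linarith [hpos 1 j k]
    rw [pow_two]
    exact mul_le_mul h2 h3 h1 (hpos 0 0 0)
  have hS : (∑ j, ∑ k, (ρ 0 j k - ρ 1 j k) ^ 2) ≤ ρ 0 0 0 := by
    calc (∑ j, ∑ k, (ρ 0 j k - ρ 1 j k) ^ 2)
        ≤ ∑ j, ∑ k, ρ 0 0 0 * (ρ 0 j k + ρ 1 j k) :=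
          Finset.sum_le_sum fun j _ => Finset.sum_le_sum fun k _ => key j k
      _ = ρ 0 0 0 * ∑ i, ∑ j, ∑ k, ρ i j k := by
          simp only [Fin.sum_univ_two]
          ring
      _ = ρ 0 0 0 := by rw [hsum, mul_one]
  refine ⟨hS, fun h => le_trans ?_ hS⟩
  have hn : 0 ≤ ∑ j, ∑ k, (ρ 0 j k - ρ 1 j k) ^ 2 :=
    Finset.sum_nonneg fun j _ => Finset.sum_nonneg fun k _ => sq_nonneg _
  have h2 := Real.sq_sqrt hn
  have h3 := Real.sq_sqrt (show (0:ℝ) ≤ 2 by norm_num)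
  have h4 := pow_le_pow_left₀ (by positivity) h 2
  rw [mul_pow, mul_pow, h2, h3] at h4
  linarith
end

section
/- Let ρ_{ijk} ≥ 0 for i,j,k ∈ {0,1} satisfy Σ_{i,j,k} ρ_{ijk} = 1 and ρ_{000} ≥ 1/2. Then h(ρ_{000}) + H(ρ_{000}+ρ_{011}, ρ_{001}+ρ_{010}, ρ_{100}+ρ_{111}, ρ_{101}+ρ_{110}) ≥ H({ρ_{ijk}}_{i,j,k∈{0,1}}), where H denotes the Shannon entropy of the listed nonnegative numbers and h is the binary entropy. -/
open BigOperators

/-- Shannon entropy contribution `−p·log₂ p` (with the convention `0·log₂ 0 = 0`,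
which holds automatically since `Real.logb 2 0 = 0`). -/
noncomputable def ent (p : ℝ) : ℝ := -(p * Real.logb 2 p)

/-- Binary entropy `h(p) = −p log₂ p − (1−p) log₂(1−p)`. -/
noncomputable def binent (p : ℝ) : ℝ := ent p + ent (1 - p)

theorem ent_eq (p : ℝ) : ent p = Real.negMulLog p / Real.log 2 := by
  unfold ent Real.negMulLog Real.logb
  ring

/-- Splitting a mass into two parts costs at most one bit. -/
theorem pair_nat (x y : ℝ) (hx : 0 ≤ x) (hy : 0 ≤ y) :
    Real.negMulLog x + Real.negMulLog y ≤ Real.negMulLog (x + y) + (x + y) * Real.log 2 := by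
  have h := Real.concaveOn_negMulLog.2 (Set.mem_Ici.2 hx) (Set.mem_Ici.2 hy)
    (by norm_num : (0 : ℝ) ≤ 1 / 2) (by norm_num : (0 : ℝ) ≤ 1 / 2) (by norm_num)
  simp only [smul_eq_mul] at h
  have e : (1 / 2 : ℝ) * x + 1 / 2 * y = (x + y) * 2⁻¹ := by ring
  rw [e, Real.negMulLog_mul] at h
  have e2 : Real.negMulLog (2⁻¹ : ℝ) = 2⁻¹ * Real.log 2 := by
    unfold Real.negMulLog
    rw [Real.log_inv]
    ring
  rw [e2] at h
  linarith

theorem pair_bits (x y : ℝ) (hx : 0 ≤ x) (hy : 0 ≤ y) :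
    ent x + ent y ≤ ent (x + y) + (x + y) := by
  have h2 : 0 < Real.log 2 := Real.log_pos (by norm_num)
  simp only [ent_eq]
  have h := div_le_div_of_nonneg_right (pair_nat x y hx hy) h2.le
  rw [add_div, add_div, mul_div_cancel_right₀ _ h2.ne'] at h
  exact h

/-- The remaining pair, by convexity of `x log x`. -/
theorem main_nat (b s q : ℝ) (hb : 0 ≤ b) (hs : 0 ≤ s) (hq : q = b + s) (hq2 : q ≤ 1 / 2) :
    Real.negMulLog b + s * Real.log 2 ≤ Real.negMulLog q + Real.negMulLog (1 - s) := by
  rcases (by linarith : 0 ≤ q).eq_or_lt with h0 | h0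
  · have hb0 : b = 0 := by linarith
    have hs0 : s = 0 := by linarith
    simp [← h0, hb0, hs0]
  have h := Real.concaveOn_negMulLog.2 (Set.mem_Ici.2 (div_nonneg hb h0.le))
    (Set.mem_Ici.2 (zero_le_one' ℝ)) h0.le (by linarith : (0 : ℝ) ≤ 1 - q) (by ring)
  simp only [smul_eq_mul, Real.negMulLog_one, mul_zero, add_zero, mul_one] at h
  have e : q * (b / q) = b := by field_simp
  have e1 : q * (b / q) + (1 - q) = 1 - s := by rw [e]; linarith
  rw [e1] at h
  have e2 := Real.negMulLog_mul q (b / q)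
  rw [e] at e2
  have hl : Real.log q ≤ - Real.log 2 := by
    rw [← Real.log_inv]
    exact Real.log_le_log h0 (by linarith)
  have e3 : b / q * Real.negMulLog q = Real.negMulLog q + s * Real.log q := by
    unfold Real.negMulLog
    field_simp
    rw [hq]
    ring
  nlinarith [mul_le_mul_of_nonneg_left hl hs]

theorem main_bits (b s q : ℝ) (hb : 0 ≤ b) (hs : 0 ≤ s) (hq : q = b + s) (hq2 : q ≤ 1 / 2) :
    ent b + s ≤ ent q + ent (1 - s) := by
  have h2 : 0 < Real.log 2 := Real.log_pos (by norm_num)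
  simp only [ent_eq]
  have h := div_le_div_of_nonneg_right (main_nat b s q hb hs hq hq2) h2.le
  rw [add_div, add_div, mul_div_cancel_right₀ _ h2.ne'] at h
  exact h

/-- for eight nonnegative reals `ρ_{ijk}` summing to 1 with `ρ_{000} ≥ 1/2`,
`h(ρ_{000}) + H(ρ_{000}+ρ_{011}, ρ_{001}+ρ_{010}, ρ_{100}+ρ_{111}, ρ_{101}+ρ_{110})
  ≥ H({ρ_{ijk}})`. -/
theorem stmt12 (ρ : Fin 2 → Fin 2 → Fin 2 → ℝ)
    (hpos : ∀ i j k, 0 ≤ ρ i j k)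
    (hsum : ∑ i, ∑ j, ∑ k, ρ i j k = 1)
    (h000 : 1 / 2 ≤ ρ 0 0 0) :
    (∑ i, ∑ j, ∑ k, ent (ρ i j k)) ≤
      binent (ρ 0 0 0)
        + (ent (ρ 0 0 0 + ρ 0 1 1) + ent (ρ 0 0 1 + ρ 0 1 0)
          + ent (ρ 1 0 0 + ρ 1 1 1) + ent (ρ 1 0 1 + ρ 1 1 0)) := by
  simp only [Fin.sum_univ_two] at hsum ⊢
  have h1 := pair_bits _ _ (hpos 0 0 1) (hpos 0 1 0)
  have h2 := pair_bits _ _ (hpos 1 0 0) (hpos 1 1 1)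
  have h3 := pair_bits _ _ (hpos 1 0 1) (hpos 1 1 0)
  have h4 := main_bits (ρ 0 1 1) (1 - (ρ 0 0 0 + ρ 0 1 1)) (1 - ρ 0 0 0) (hpos 0 1 1)
    (by linarith [hpos 0 0 1, hpos 0 1 0, hpos 1 0 0, hpos 1 1 1, hpos 1 0 1, hpos 1 1 0])
    (by ring) (by linarith)
  rw [sub_sub_cancel] at h4
  unfold binent
  linarith
end

section
/- Define g(x,y) = −(x+y)·log₂(x+y) − (1−x)·log₂(2(1−x)) + y·log₂(2y) for real x, y, with the convention 0·log₂ 0 = 0. Then g(x,y) ≥ 0 for all x, y with 1/2 ≤ x ≤ 1 and 0 ≤ y ≤ 1−x. Moreover, in this region g(x,y) ≥ ((1−x−y)/(1/2−y))·g(1/2,y) whenever y < 1/2. -/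
/-- The function `g(x,y) = −(x+y)log₂(x+y) − (1−x)log₂(2(1−x)) + y·log₂(2y)`.
The convention `0·log₂ 0 = 0` holds automatically since `Real.logb 2 0 = 0`. -/
noncomputable def g (x y : ℝ) : ℝ :=
  -((x + y) * Real.logb 2 (x + y)) - (1 - x) * Real.logb 2 (2 * (1 - x))
    + y * Real.logb 2 (2 * y)

theorem g_eq (x y : ℝ) : g x y = (Real.negMulLog (x + y) + Real.negMulLog (2 * (1 - x)) / 2
    + y * Real.log (2 * y)) / Real.log 2 := by
  unfold g Real.negMulLog Real.logb
  ring

theorem nml_conc (a b t : ℝ) (ha : 0 ≤ a) (hb : 0 ≤ b) (h0 : 0 ≤ t) (h1 : t ≤ 1) :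
    t * Real.negMulLog a + (1 - t) * Real.negMulLog b ≤ Real.negMulLog (t * a + (1 - t) * b) := by
  have h := Real.concaveOn_negMulLog.2 (x := a) (y := b) ha hb h0 (sub_nonneg.2 h1) (by ring)
  simpa [smul_eq_mul] using h

theorem g_half (y : ℝ) (hy : 0 ≤ y) : 0 ≤ g (1 / 2) y := by
  rw [g_eq]
  have h := nml_conc 1 (2 * y) (1 / 2) (by norm_num) (by linarith) (by norm_num) (by norm_num)
  rw [show (1 / 2 * 1 + (1 - 1 / 2) * (2 * y) : ℝ) = 1 / 2 + y by ring, Real.negMulLog_one] at h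
  have e : Real.negMulLog (2 * y) = -(2 * y * Real.log (2 * y)) := by
    unfold Real.negMulLog; ring
  rw [e] at h
  apply div_nonneg _ (Real.log_nonneg (by norm_num))
  rw [show (2 * (1 - 1 / 2) : ℝ) = 1 by norm_num, Real.negMulLog_one]
  linarith

theorem g_main (x y : ℝ) (hx1 : 1 / 2 ≤ x) (hy1 : 0 ≤ y)
    (hy2 : y ≤ 1 - x) (hy : y < 1 / 2) :
    ((1 - x - y) / (1 / 2 - y)) * g (1 / 2) y ≤ g x y := by
  have hp : 0 < 1 / 2 - y := by linarith
  obtain ⟨t, ht⟩ : ∃ t, t = (1 - x - y) / (1 / 2 - y) := ⟨_, rfl⟩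
  have h0 : 0 ≤ t := by rw [ht]; exact div_nonneg (by linarith) hp.le
  have h1 : t ≤ 1 := by rw [ht, div_le_one hp]; linarith
  have hm : t * (1 / 2 - y) = 1 - x - y := by rw [ht]; exact div_mul_cancel₀ _ hp.ne'
  rw [← ht]
  have ha := nml_conc (1 / 2 + y) 1 t (by linarith) (by norm_num) h0 h1
  have hb := nml_conc 1 (2 * y) t (by norm_num) (by linarith) h0 h1
  rw [show t * (1 / 2 + y) + (1 - t) * 1 = x + y by linarith, Real.negMulLog_one] at ha
  rw [show t * 1 + (1 - t) * (2 * y) = 2 * (1 - x) by linarith, Real.negMulLog_one] at hb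
  have e : Real.negMulLog (2 * y) = -(2 * y * Real.log (2 * y)) := by
    unfold Real.negMulLog; ring
  rw [e] at hb
  rw [g_eq, g_eq, ← mul_div_assoc]
  apply div_le_div_of_nonneg_right _ (Real.log_nonneg (by norm_num))
  rw [show (2 * (1 - 1 / 2) : ℝ) = 1 by norm_num, Real.negMulLog_one]
  linarith

/-- `g(x,y) ≥ 0` for `1/2 ≤ x ≤ 1`, `0 ≤ y ≤ 1−x`, and moreover
`g(x,y) ≥ ((1−x−y)/(1/2−y))·g(1/2,y)` whenever `y < 1/2` in that region. -/
theorem stmt13 (x y : ℝ) (hx1 : 1 / 2 ≤ x) (hx2 : x ≤ 1) (hy1 : 0 ≤ y)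
    (hy2 : y ≤ 1 - x) :
    0 ≤ g x y ∧
    (y < 1 / 2 → ((1 - x - y) / (1 / 2 - y)) * g (1 / 2) y ≤ g x y) := by
  refine ⟨?_, g_main x y hx1 hy1 hy2⟩
  rcases lt_or_ge y (1 / 2) with hy | hy
  · refine le_trans (mul_nonneg (div_nonneg ?_ ?_) (g_half y hy1)) (g_main x y hx1 hy1 hy2 hy) <;>
      linarith
  · have : x = 1 / 2 := by linarith
    rw [this]
    exact g_half y hy1
end

section
/- Let q₁, q₂, q₃, q₄ ≥ 0 satisfy q₁ + q₂ + q₃ + q₄ = 1, let 2 ≤ m ≤ 4, and suppose q₁² + q₂² + q₃² + q₄² ≥ m²/16. Then H(q₁, q₂, q₃, q₄) ≤ H(ν_m, (1−ν_m)/3, (1−ν_m)/3, (1−ν_m)/3), where ν_m = 1/4 + (√3/8)·√(m² − 4) and H is the Shannon entropy. Consequently, H(q₁,q₂,q₃,q₄) ≤ 2 − [2 − H(1−3f, f, f, f)] with f = (1−ν_m)/3 = 1/4 − (√3/24)·√(m² − 4). -/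
open BigOperators

/-- Tangent line inequality for `x log x`. -/
lemma aux_tangent (x y : ℝ) (hx : 0 < x) (hy : 0 ≤ y) :
    x * Real.log x + (Real.log x + 1) * (y - x) ≤ y * Real.log y := by
  rcases hy.eq_or_lt with h | h
  · subst h; simp; nlinarith
  · have h1 := Real.log_le_sub_one_of_pos (div_pos hx h)
    rw [Real.log_div hx.ne' h.ne'] at h1
    have h2 : y * (Real.log x - Real.log y) ≤ y * (x / y - 1) :=
      mul_le_mul_of_nonneg_left h1 h.le
    have h3 : y * (x / y - 1) = x - y := by field_simp
    nlinarith

lemma aux_mono (a b : ℝ) (ha : 1 / 4 ≤ a) (hab : a ≤ b) (hb : b ≤ 1) :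
    a * Real.log a + 3 * ((1 - a) / 3 * Real.log ((1 - a) / 3)) ≤
    b * Real.log b + 3 * ((1 - b) / 3 * Real.log ((1 - b) / 3)) := by
  by_cases h1 : a = 1
  · have : b = 1 := by linarith
    subst h1; subst this; exact le_rfl
  · have h2 : a < 1 := lt_of_le_of_ne (hab.trans hb) h1
    have t1 := aux_tangent a b (by linarith) (by linarith)
    have t2 := aux_tangent ((1 - a) / 3) ((1 - b) / 3) (by linarith) (by linarith)
    have h3 : Real.log ((1 - a) / 3) ≤ Real.log a :=
      Real.log_le_log (by linarith) (by linarith)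
    nlinarith [mul_nonneg (sub_nonneg.2 h3) (sub_nonneg.2 hab)]

lemma aux_r : AntitoneOn (fun t : ℝ => t * Real.log t - t + 1 - (t - 1) ^ 2 / 2) (Set.Ici 0) := by
  have hd : ∀ t : ℝ, 0 < t → HasDerivAt
      (fun t : ℝ => t * Real.log t - t + 1 - (t - 1) ^ 2 / 2)
      (Real.log t + 1 - 1 - (2 * (t - 1) ^ 1 * 1) / 2) t := by
    intro t ht
    have h1 : HasDerivAt (fun t : ℝ => t * Real.log t - t + 1) (Real.log t + 1 - 1) t :=
      (((Real.hasDerivAt_mul_log ht.ne').sub (hasDerivAt_id' t)).add_const 1)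
    have h0 : HasDerivAt (fun t : ℝ => (t - 1) ^ 2) (2 * (t - 1) ^ 1 * 1) t := by
      have := ((hasDerivAt_id' t).sub_const 1).pow 2
      rw [Nat.cast_ofNat] at this
      exact this
    exact h1.sub (h0.div_const 2)
  apply antitoneOn_of_deriv_nonpos (convex_Ici 0)
  · have h : Continuous (fun t : ℝ => t * Real.log t) := Real.continuous_mul_log
    have h' : Continuous (fun t : ℝ => t * Real.log t - t + 1 - (t - 1) ^ 2 / 2) := by
      apply Continuous.sub _ (by fun_prop)
      exact (h.sub continuous_id).add continuous_const
    exact h'.continuousOn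
  · intro t ht
    rw [interior_Ici] at ht
    exact (hd t ht).differentiableAt.differentiableWithinAt
  · intro t ht
    rw [interior_Ici] at ht
    rw [(hd t ht).deriv]
    have := Real.log_le_sub_one_of_pos ht
    linarith

lemma aux_log : MonotoneOn (fun t : ℝ => (t + 1) * Real.log t - 2 * (t - 1)) (Set.Ici 1) := by
  have hd : ∀ t : ℝ, 0 < t → HasDerivAt (fun t : ℝ => (t + 1) * Real.log t - 2 * (t - 1))
        ((1 * Real.log t + (t + 1) * t⁻¹) - 2 * 1) t := by
    intro t ht
    exact (((hasDerivAt_id t).add_const 1).mul (Real.hasDerivAt_log ht.ne')).sub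
        (((hasDerivAt_id t).sub_const 1).const_mul 2)
  apply monotoneOn_of_deriv_nonneg (convex_Ici 1)
  · intro t ht
    exact (hd t (lt_of_lt_of_le one_pos ht)).continuousAt.continuousWithinAt
  · intro t ht
    rw [interior_Ici] at ht
    exact (hd t (lt_trans one_pos ht)).differentiableAt.differentiableWithinAt
  · intro t ht
    rw [interior_Ici] at ht
    have ht0 : (0:ℝ) < t := lt_trans one_pos ht
    rw [(hd t ht0).deriv]
    have := Real.one_sub_inv_le_log_of_pos ht0
    have h2 : (t + 1) * t⁻¹ = 1 + t⁻¹ := by field_simp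
    rw [h2]; linarith

lemma aux_psi : AntitoneOn (fun t : ℝ => (t * Real.log t - t + 1) / (t - 1) ^ 2) (Set.Ioi 1) := by
  have hd : ∀ t : ℝ, 1 < t → HasDerivAt (fun t : ℝ => (t * Real.log t - t + 1) / (t - 1) ^ 2)
        (((Real.log t + 1 - 1) * (t - 1) ^ 2 - (t * Real.log t - t + 1) *
          (2 * (t - 1) ^ 1 * 1)) / ((t - 1) ^ 2) ^ 2) t := by
    intro t ht
    have h1 : t - 1 ≠ 0 := by linarith
    exact (((Real.hasDerivAt_mul_log (by linarith : t ≠ 0)).sub (hasDerivAt_id t)).add_const 1).div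
        (((hasDerivAt_id t).sub_const 1).pow 2) (pow_ne_zero 2 h1)
  apply antitoneOn_of_deriv_nonpos (convex_Ioi 1)
  · intro t ht
    exact (hd t ht).continuousAt.continuousWithinAt
  · intro t ht
    rw [interior_Ioi] at ht
    exact (hd t ht).differentiableAt.differentiableWithinAt
  · intro t ht
    rw [interior_Ioi] at ht
    have ht1 : (1:ℝ) < t := ht
    rw [(hd t ht).deriv]
    apply div_nonpos_of_nonpos_of_nonneg _ (by positivity)
    have h := aux_log (Set.mem_Ici.2 le_rfl) (Set.mem_Ici.2 ht1.le) ht1.le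
    simp only [Real.log_one] at h
    nlinarith [mul_nonneg (sub_nonneg.2 ht1.le) (sub_nonneg.2 h)]

/-- Quadratic minorant of `t log t - t + 1` touching at `1` and at `T`. -/
lemma aux_quad (t T : ℝ) (hT : 1 < T) (ht : 0 ≤ t) (htT : t ≤ T) :
    (T * Real.log T - T + 1) / (T - 1) ^ 2 * (t - 1) ^ 2 ≤ t * Real.log t - t + 1 := by
  rcases le_or_gt t 1 with h | h
  · have h1 := aux_r (Set.mem_Ici.2 ht) (Set.mem_Ici.2 zero_le_one) h
    have h2 := aux_r (Set.mem_Ici.2 zero_le_one) (Set.mem_Ici.2 (by linarith : (0:ℝ) ≤ T)) hT.le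
    simp only [Real.log_one] at h1 h2
    have h3 : (T * Real.log T - T + 1) / (T - 1) ^ 2 ≤ 1 / 2 := by
      rw [div_le_iff₀ (by have : 0 < T - 1 := by linarith
                          positivity)]
      linarith
    nlinarith [mul_le_mul_of_nonneg_right h3 (sq_nonneg (t - 1))]
  · have h1 := aux_psi (Set.mem_Ioi.2 h) (Set.mem_Ioi.2 hT) htT
    have h0 : 0 < t - 1 := by linarith
    have h2 : 0 < (t - 1) ^ 2 := by positivity
    simp only at h1
    rwa [le_div_iff₀ h2] at h1

/-- Scaled version. -/
lemma aux_scaled (f v : ℝ) (hf : 0 < f) (hv : f < v) : ∃ K A B : ℝ,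
    (v * Real.log v = A + B * v + K * (v - f) ^ 2) ∧ (f * Real.log f = A + B * f) ∧
    ∀ x, 0 ≤ x → x ≤ v → A + B * x + K * (x - f) ^ 2 ≤ x * Real.log x := by
  have key : ∀ t : ℝ, 0 ≤ t → (f * t) * Real.log (f * t) =
      f * (t * Real.log t - t + 1) + (Real.log f + 1) * (f * t) - f := by
    intro t ht
    rcases ht.eq_or_lt with h | h
    · subst h; simp
    · rw [Real.log_mul hf.ne' h.ne']; ring
  obtain ⟨T, rfl⟩ : ∃ T, v = f * T := ⟨v / f, by field_simp⟩
  have hT : 1 < T := by nlinarith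
  have hT' : T - 1 ≠ 0 := by linarith
  refine ⟨(T * Real.log T - T + 1) / (T - 1) ^ 2 / f, -f, Real.log f + 1, ?_, by ring, ?_⟩
  · rw [key T (by linarith)]; field_simp; ring
  · intro x hx hxv
    obtain ⟨t, rfl⟩ : ∃ t, x = f * t := ⟨x / f, by field_simp⟩
    have ht : 0 ≤ t := nonneg_of_mul_nonneg_right hx hf
    have htT : t ≤ T := le_of_mul_le_mul_left hxv hf
    rw [key t ht]
    have h1 := mul_le_mul_of_nonneg_left (aux_quad t T hT ht htT) hf.le
    have h2 : (T * Real.log T - T + 1) / (T - 1) ^ 2 / f * (f * t - f) ^ 2 =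
      f * ((T * Real.log T - T + 1) / (T - 1) ^ 2 * (t - 1) ^ 2) := by field_simp
    rw [h2]; linarith

/-- Main inequality, natural logarithm, four variables, `s = ν - 1/4`. -/
lemma aux_main (a b c d s : ℝ) (ha : 0 ≤ a) (hb : 0 ≤ b) (hc : 0 ≤ c) (hd : 0 ≤ d)
    (hs : 0 ≤ s) (hsum : a + b + c + d = 1)
    (hsq : a ^ 2 + b ^ 2 + c ^ 2 + d ^ 2 = 1 / 4 + 4 / 3 * s ^ 2) :
    (1 / 4 + s) * Real.log (1 / 4 + s) +
      3 * ((1 - (1 / 4 + s)) / 3 * Real.log ((1 - (1 / 4 + s)) / 3)) ≤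
    a * Real.log a + b * Real.log b + c * Real.log c + d * Real.log d := by
  have bound : ∀ x y z w : ℝ, x + y + z + w = 1 →
      x ^ 2 + y ^ 2 + z ^ 2 + w ^ 2 = 1 / 4 + 4 / 3 * s ^ 2 → x ≤ 1 / 4 + s := by
    intro x y z w h1 h2
    have hw : w = 1 - x - y - z := by linarith
    have : (x - 1 / 4) ^ 2 ≤ s ^ 2 := by
      subst hw
      nlinarith [sq_nonneg (y - z), sq_nonneg (y - (1 - x - y - z)),
        sq_nonneg (z - (1 - x - y - z))]
    have := (abs_le.1 (abs_le_of_sq_le_sq this hs)).2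
    linarith
  have ba := bound a b c d hsum hsq
  have bb := bound b a c d (by linarith) (by linarith)
  have bc := bound c a b d (by linarith) (by linarith)
  have bd := bound d a b c (by linarith) (by linarith)
  have hs1 : s ≤ 3 / 4 := by
    nlinarith [mul_nonneg ha hb, mul_nonneg ha hc, mul_nonneg ha hd, mul_nonneg hb hc,
      mul_nonneg hb hd, mul_nonneg hc hd]
  rcases hs.eq_or_lt with h | h
  · subst h
    have e1 : a = 1 / 4 := by linarith
    have e2 : b = 1 / 4 := by linarith
    have e3 : c = 1 / 4 := by linarith
    have e4 : d = 1 / 4 := by linarith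
    subst e1 e2 e3 e4
    norm_num
    linarith
  rcases hs1.eq_or_lt with h1 | h1
  · subst h1
    have e : ∀ x : ℝ, 0 ≤ x → x ≤ 1 → x - x ^ 2 ≤ 0 → x * Real.log x = 0 := by
      intro x h0 h1 h2
      have : x * (1 - x) = 0 := le_antisymm (by linarith) (mul_nonneg h0 (by linarith))
      rcases mul_eq_zero.1 this with h | h
      · simp [h]
      · have : x = 1 := by linarith
        simp [this]
    have na : 0 ≤ a - a ^ 2 := by nlinarith
    have nb : 0 ≤ b - b ^ 2 := by nlinarith
    have nc : 0 ≤ c - c ^ 2 := by nlinarith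
    have nd : 0 ≤ d - d ^ 2 := by nlinarith
    rw [e a ha (by linarith) (by linarith), e b hb (by linarith) (by linarith),
      e c hc (by linarith) (by linarith), e d hd (by linarith) (by linarith)]
    norm_num
  obtain ⟨K, A, B, h2, h3, h4⟩ := aux_scaled ((1 - (1 / 4 + s)) / 3) (1 / 4 + s)
    (by linarith) (by linarith)
  have i1 := h4 a ha ba
  have i2 := h4 b hb bb
  have i3 := h4 c hc bc
  have i4 := h4 d hd bd
  rw [h2, h3]
  refine le_trans (le_of_eq ?_) (add_le_add (add_le_add (add_le_add i1 i2) i3) i4)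
  have hd' : d = 1 - a - b - c := by linarith
  subst hd'
  linear_combination (-K) * hsq

lemma aux_ent (x : ℝ) : ent x = -(x * Real.log x) / Real.log 2 := by
  unfold ent Real.logb; ring

/-- for nonnegative `q₁,…,q₄` summing to 1, `2 ≤ m ≤ 4` with
`Σ qᵢ² ≥ m²/16`, the Shannon entropy `H(q)` is at most
`H(ν_m, (1−ν_m)/3, (1−ν_m)/3, (1−ν_m)/3)` with `ν_m = 1/4 + (√3/8)√(m²−4)`;
consequently `H(q) ≤ 2 − [2 − H(1−3f, f, f, f)]` with
`f = 1/4 − (√3/24)√(m²−4)`. -/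
theorem stmt16 (q : Fin 4 → ℝ) (hq : ∀ i, 0 ≤ q i) (hsum : ∑ i, q i = 1)
    (m : ℝ) (hm1 : 2 ≤ m) (hm2 : m ≤ 4)
    (hineq : m ^ 2 / 16 ≤ ∑ i, q i ^ 2) :
    ((∑ i, ent (q i)) ≤
      ent (1 / 4 + Real.sqrt 3 / 8 * Real.sqrt (m ^ 2 - 4))
        + 3 * ent ((1 - (1 / 4 + Real.sqrt 3 / 8 * Real.sqrt (m ^ 2 - 4))) / 3)) ∧
    ((∑ i, ent (q i)) ≤ 2 - (2 -
      (ent (1 - 3 * (1 / 4 - Real.sqrt 3 / 24 * Real.sqrt (m ^ 2 - 4)))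
        + 3 * ent (1 / 4 - Real.sqrt 3 / 24 * Real.sqrt (m ^ 2 - 4))))) := by
  have first : (∑ i, ent (q i)) ≤
      ent (1 / 4 + Real.sqrt 3 / 8 * Real.sqrt (m ^ 2 - 4))
        + 3 * ent ((1 - (1 / 4 + Real.sqrt 3 / 8 * Real.sqrt (m ^ 2 - 4))) / 3) := by
    simp only [Fin.sum_univ_four] at *
    have p0 := hq 0
    have p1 := hq 1
    have p2 := hq 2
    have p3 := hq 3
    generalize q 0 = a at *
    generalize q 1 = b at *
    generalize q 2 = c at *
    generalize q 3 = d at *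
    have hS : 0 ≤ 3 / 4 * (a ^ 2 + b ^ 2 + c ^ 2 + d ^ 2 - 1 / 4) := by nlinarith
    obtain ⟨s, hs, hss⟩ : ∃ s : ℝ, 0 ≤ s ∧
        s ^ 2 = 3 / 4 * (a ^ 2 + b ^ 2 + c ^ 2 + d ^ 2 - 1 / 4) :=
      ⟨_, Real.sqrt_nonneg _, Real.sq_sqrt hS⟩
    have hm4 : 0 ≤ m ^ 2 - 4 := by nlinarith
    have hu : 0 ≤ Real.sqrt 3 / 8 * Real.sqrt (m ^ 2 - 4) := by positivity
    have huu : (Real.sqrt 3 / 8 * Real.sqrt (m ^ 2 - 4)) ^ 2 = 3 / 64 * (m ^ 2 - 4) := by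
      rw [mul_pow, div_pow, Real.sq_sqrt hm4, Real.sq_sqrt (by norm_num)]; norm_num
    generalize Real.sqrt 3 / 8 * Real.sqrt (m ^ 2 - 4) = u at *
    have hus : u ≤ s := by
      exact (sq_le_sq₀ hu hs).1 (by linarith)
    have hs1 : s ≤ 3 / 4 := by
      nlinarith [mul_nonneg p0 p1, mul_nonneg p0 p2, mul_nonneg p0 p3, mul_nonneg p1 p2,
        mul_nonneg p1 p3, mul_nonneg p2 p3]
    have k1 := aux_main a b c d s p0 p1 p2 p3 hs hsum (by linarith)
    have k2 := aux_mono (1 / 4 + u) (1 / 4 + s) (by linarith) (by linarith) (by linarith)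
    have k3 := k2.trans k1
    simp only [aux_ent]
    have hl : 0 < Real.log 2 := Real.log_pos (by norm_num)
    rw [← mul_div_assoc, ← add_div, ← add_div, ← add_div, ← add_div]
    apply div_le_div_of_nonneg_right _ hl.le
    linarith
  refine ⟨first, ?_⟩
  have e1 : 1 - 3 * (1 / 4 - Real.sqrt 3 / 24 * Real.sqrt (m ^ 2 - 4)) =
      1 / 4 + Real.sqrt 3 / 8 * Real.sqrt (m ^ 2 - 4) := by ring
  have e2 : 1 / 4 - Real.sqrt 3 / 24 * Real.sqrt (m ^ 2 - 4) =
      (1 - (1 / 4 + Real.sqrt 3 / 8 * Real.sqrt (m ^ 2 - 4))) / 3 := by ring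
  rw [e1, e2]
  linarith
end

section
/- For ν ∈ [0,1], let τ(ν) = ν·|ψ_{0,0,0}⟩⟨ψ_{0,0,0}| + (1−ν)·|ψ_{0,1,1}⟩⟨ψ_{0,1,1}| be the 3-qubit state where |ψ_{0,j,k}⟩ = (|0,j,k⟩ + |1,j̄,k̄⟩)/√2. Then the value 4·√(ν² + (1−ν)²) is the greatest value of Tr[M₃ τ(ν)] over all choices of unit vectors a₀, a₁, b₀, b₁, c₀, c₁ ∈ ℝ³ defining observables A_x = a_x·σ⃗, B_y = b_y·σ⃗, C_z = c_z·σ⃗: every such choice gives Tr[M₃ τ(ν)] ≤ 4√(ν² + (1−ν)²), and some choice attains equality. -/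
open BigOperators Matrix Kronecker

/-- The state `τ(ν) = ν|ψ₀₀₀⟩⟨ψ₀₀₀| + (1−ν)|ψ₀₁₁⟩⟨ψ₀₁₁|`. -/
noncomputable def tau (ν : ℝ) :
    Matrix ((Fin 2 × Fin 2) × Fin 2) ((Fin 2 × Fin 2) × Fin 2) ℂ :=
  (ν : ℂ) • outer (ghz 0 0 0) (ghz 0 0 0)
    + ((1 - ν : ℝ) : ℂ) • outer (ghz 0 1 1) (ghz 0 1 1)

/-- The three-body correlator of `τ(ν)`. -/
lemma trace_term (ν : ℝ) (a b c : Fin 3 → ℝ) :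
    (Matrix.trace ((obs a ⊗ₖ obs b ⊗ₖ obs c) * tau ν)) =
      ((a 0 * (b 0 * c 0 - b 1 * c 1) - (2 * ν - 1) * a 1 * (b 0 * c 1 + b 1 * c 0) : ℝ) : ℂ) := by
  have h2 : (((Real.sqrt 2)⁻¹ : ℝ) : ℂ) * (starRingEnd ℂ) (((Real.sqrt 2)⁻¹ : ℝ) : ℂ) = 1 / 2 := by
    rw [Complex.conj_ofReal, ← Complex.ofReal_mul, ← mul_inv, Real.mul_self_sqrt (by norm_num)]
    push_cast
    norm_num
  have hI : Complex.I * Complex.I = -1 := Complex.I_mul_I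
  simp only [Matrix.trace, Matrix.diag, Matrix.mul_apply, Fintype.sum_prod_type, Fin.sum_univ_two,
    Matrix.kroneckerMap_apply, tau, outer, ghz, Matrix.add_apply, Matrix.smul_apply, obs,
    Fin.sum_univ_three, pauli, map_add, smul_eq_mul]
  simp only [Prod.mk.injEq, Fin.isValue, sub_zero, sub_self, Matrix.of_apply, Matrix.cons_val',
    Matrix.cons_val_zero, Matrix.cons_val_one, Matrix.cons_val_fin_one]
  generalize (((Real.sqrt 2)⁻¹ : ℝ) : ℂ) = s at *
  norm_num
  linear_combination (2 * ((a 0 : ℂ) * b 0 * c 0 - ((a 0 : ℂ) * b 1 * c 1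
      + (2 * (ν : ℂ) - 1) * a 1 * (b 0 * c 1 + b 1 * c 0)))) * h2
      + (2 * (s * (starRingEnd ℂ) s) * ((a 0 : ℂ) * b 1 * c 1
      + (2 * (ν : ℂ) - 1) * a 1 * (b 0 * c 1 + b 1 * c 0))) * hI

lemma trace_mabk (ν : ℝ) (a₀ a₁ b₀ b₁ c₀ c₁ : Fin 3 → ℝ) :
    (Matrix.trace
      (mabk3 (obs a₀) (obs a₁) (obs b₀) (obs b₁) (obs c₀) (obs c₁) * tau ν)).re =
    a₀ 0 * (b₀ 0 * c₁ 0 - b₀ 1 * c₁ 1 + (b₁ 0 * c₀ 0 - b₁ 1 * c₀ 1))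
    + a₁ 0 * (b₀ 0 * c₀ 0 - b₀ 1 * c₀ 1 - (b₁ 0 * c₁ 0 - b₁ 1 * c₁ 1))
    - (2 * ν - 1) * (a₀ 1 * (b₀ 0 * c₁ 1 + b₀ 1 * c₁ 0 + (b₁ 0 * c₀ 1 + b₁ 1 * c₀ 0))
    + a₁ 1 * (b₀ 0 * c₀ 1 + b₀ 1 * c₀ 0 - (b₁ 0 * c₁ 1 + b₁ 1 * c₁ 0))) := by
  rw [mabk3, Matrix.sub_mul, Matrix.add_mul, Matrix.add_mul, Matrix.trace_sub, Matrix.trace_add,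
    Matrix.trace_add, trace_term, trace_term, trace_term, trace_term]
  simp only [Complex.add_re, Complex.sub_re, Complex.ofReal_re]
  ring

/-- A Cauchy-Schwarz bound for a difference of two complex products. -/
lemma cauchy_complex (x0 x1 u0 u1 y0 y1 w0 w1 : ℝ)
    (hx : x0 ^ 2 + x1 ^ 2 + (u0 ^ 2 + u1 ^ 2) ≤ 2) (hy : y0 ^ 2 + y1 ^ 2 + (w0 ^ 2 + w1 ^ 2) ≤ 2) :
    (x0 * y1 - u0 * w1 + (x1 * y0 - u1 * w0)) ^ 2
      + (x0 * y0 - u0 * w0 - (x1 * y1 - u1 * w1)) ^ 2 ≤ 4 := by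
  have key : (x0 * y1 - u0 * w1 + (x1 * y0 - u1 * w0)) ^ 2
      + (x0 * y0 - u0 * w0 - (x1 * y1 - u1 * w1)) ^ 2 ≤
      (x0 ^ 2 + x1 ^ 2 + (u0 ^ 2 + u1 ^ 2)) * (y0 ^ 2 + y1 ^ 2 + (w0 ^ 2 + w1 ^ 2)) := by
    have e : (x0 ^ 2 + x1 ^ 2 + (u0 ^ 2 + u1 ^ 2)) * (y0 ^ 2 + y1 ^ 2 + (w0 ^ 2 + w1 ^ 2))
      - ((x0 * y1 - u0 * w1 + (x1 * y0 - u1 * w0)) ^ 2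
      + (x0 * y0 - u0 * w0 - (x1 * y1 - u1 * w1)) ^ 2)
      = (x0 * w0 + x1 * w1 + (u0 * y0 + u1 * y1)) ^ 2
        + (x1 * w0 - x0 * w1 + (u1 * y0 - u0 * y1)) ^ 2 := by ring
    nlinarith [sq_nonneg (x0 * w0 + x1 * w1 + (u0 * y0 + u1 * y1)),
      sq_nonneg (x1 * w0 - x0 * w1 + (u1 * y0 - u0 * y1))]
  have : (x0 ^ 2 + x1 ^ 2 + (u0 ^ 2 + u1 ^ 2)) * (y0 ^ 2 + y1 ^ 2 + (w0 ^ 2 + w1 ^ 2)) ≤ 2 * 2 :=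
    mul_le_mul hx hy (by positivity) (by norm_num)
  linarith

/-- Cauchy-Schwarz for the first party. -/
lemma cauchy_first (p0 q0 p1 q1 U0 U1 V0 V1 m : ℝ) (h0 : p0 ^ 2 + q0 ^ 2 ≤ 1)
    (h1 : p1 ^ 2 + q1 ^ 2 ≤ 1) (hU : U0 ^ 2 + U1 ^ 2 ≤ 4) (hV : V0 ^ 2 + V1 ^ 2 ≤ 4) :
    (p0 * U0 + p1 * U1 - m * (q0 * V0 + q1 * V1)) ^ 2 ≤ 8 * (1 + m ^ 2) := by
  have key := Finset.sum_mul_sq_le_sq_mul_sq Finset.univ ![p0, p1, q0, q1]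
    ![U0, U1, -(m * V0), -(m * V1)]
  simp [Fin.sum_univ_four] at key
  have hm : m ^ 2 * (V0 ^ 2 + V1 ^ 2) ≤ m ^ 2 * 4 := mul_le_mul_of_nonneg_left hV (sq_nonneg m)
  have : (p0 ^ 2 + p1 ^ 2 + q0 ^ 2 + q1 ^ 2) * (U0 ^ 2 + U1 ^ 2 + (m * V0) ^ 2 + (m * V1) ^ 2)
      ≤ 2 * (4 + m ^ 2 * 4) :=
    mul_le_mul (by linarith) (by nlinarith) (by positivity) (by norm_num)
  calc _ = (p0 * U0 + p1 * U1 + -(q0 * (m * V0)) + -(q1 * (m * V1))) ^ 2 := by ring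
    _ ≤ _ := key
    _ ≤ _ := this
    _ = _ := by ring

/-- for `ν ∈ [0,1]`, the value `4√(ν² + (1−ν)²)` is the greatest value of
`Tr[M₃ τ(ν)]` over all choices of unit vectors `a₀,a₁,b₀,b₁,c₀,c₁ ∈ ℝ³` defining the
observables `A_x = a_x·σ⃗`, `B_y = b_y·σ⃗`, `C_z = c_z·σ⃗`. -/
theorem stmt17 (ν : ℝ) (hν0 : 0 ≤ ν) (hν1 : ν ≤ 1) :
    IsGreatest
      {x : ℝ | ∃ a₀ a₁ b₀ b₁ c₀ c₁ : Fin 3 → ℝ,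
        (∑ t, a₀ t ^ 2 = 1) ∧ (∑ t, a₁ t ^ 2 = 1) ∧
        (∑ t, b₀ t ^ 2 = 1) ∧ (∑ t, b₁ t ^ 2 = 1) ∧
        (∑ t, c₀ t ^ 2 = 1) ∧ (∑ t, c₁ t ^ 2 = 1) ∧
        x = (Matrix.trace
          (mabk3 (obs a₀) (obs a₁) (obs b₀) (obs b₁) (obs c₀) (obs c₁) * tau ν)).re}
      (4 * Real.sqrt (ν ^ 2 + (1 - ν) ^ 2)) := by
  constructor
  · set n := Real.sqrt (1 + (2 * ν - 1) ^ 2) with hn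
    have hpos : 0 < 1 + (2 * ν - 1) ^ 2 := by positivity
    have hn0 : 0 < n := Real.sqrt_pos.2 hpos
    have hn2 : n ^ 2 = 1 + (2 * ν - 1) ^ 2 := Real.sq_sqrt hpos.le
    have hs0 : 0 < Real.sqrt 2 := by positivity
    have hs2 : Real.sqrt 2 ^ 2 = 2 := Real.sq_sqrt (by norm_num)
    have hval : 4 * Real.sqrt (ν ^ 2 + (1 - ν) ^ 2) = 2 * Real.sqrt 2 * n := by
      have : (ν ^ 2 + (1 - ν) ^ 2) = (Real.sqrt 2 * n / 2) ^ 2 := by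
        rw [div_pow, mul_pow, hs2, hn2]; ring
      rw [this, Real.sqrt_sq (by positivity)]; ring
    refine ⟨![1 / n, -(2 * ν - 1) / n, 0], ![1 / n, (2 * ν - 1) / n, 0], ![1, 0, 0], ![0, 1, 0],
      ![Real.sqrt 2 / 2, -(Real.sqrt 2 / 2), 0], ![Real.sqrt 2 / 2, Real.sqrt 2 / 2, 0],
      ?_, ?_, ?_, ?_, ?_, ?_, ?_⟩
    · simp [Fin.sum_univ_three]; field_simp; linarith
    · simp [Fin.sum_univ_three]; field_simp; linarith
    · simp [Fin.sum_univ_three]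
    · simp [Fin.sum_univ_three]
    · simp [Fin.sum_univ_three, div_pow]; norm_num
    · simp [Fin.sum_univ_three, div_pow]; norm_num
    · rw [trace_mabk, hval]
      simp only [Matrix.cons_val_zero, Matrix.cons_val_one]
      have : 2 * Real.sqrt 2 * n = 2 * Real.sqrt 2 * (n ^ 2 / n) := by field_simp
      rw [this, hn2]
      ring
  · rintro x ⟨a₀, a₁, b₀, b₁, c₀, c₁, ha₀, ha₁, hb₀, hb₁, hc₀, hc₁, rfl⟩
    rw [trace_mabk]
    simp only [Fin.sum_univ_three] at ha₀ ha₁ hb₀ hb₁ hc₀ hc₁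
    have hb : b₀ 0 ^ 2 + b₁ 0 ^ 2 + (b₀ 1 ^ 2 + b₁ 1 ^ 2) ≤ 2 := by
      nlinarith [sq_nonneg (b₀ 2), sq_nonneg (b₁ 2)]
    have hc : c₀ 0 ^ 2 + c₁ 0 ^ 2 + (c₀ 1 ^ 2 + c₁ 1 ^ 2) ≤ 2 := by
      nlinarith [sq_nonneg (c₀ 2), sq_nonneg (c₁ 2)]
    have hU := cauchy_complex (b₀ 0) (b₁ 0) (b₀ 1) (b₁ 1) (c₀ 0) (c₁ 0) (c₀ 1) (c₁ 1) hb hc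
    have hV := cauchy_complex (b₀ 0) (b₁ 0) (b₀ 1) (b₁ 1) (c₀ 1) (c₁ 1) (-c₀ 0) (-c₁ 0) hb
      (by linarith [neg_sq (c₀ 0), neg_sq (c₁ 0)])
    simp only [mul_neg, sub_neg_eq_add] at hV
    have h := cauchy_first (a₀ 0) (a₀ 1) (a₁ 0) (a₁ 1) _ _ _ _ (2 * ν - 1)
      (by nlinarith [sq_nonneg (a₀ 2)]) (by nlinarith [sq_nonneg (a₁ 2)]) hU hV
    refine abs_le_of_sq_le_sq' (h.trans (le_of_eq ?_)) (by positivity) |>.2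
    rw [mul_pow, Real.sq_sqrt (by positivity)]
    ring
end

section
/- Let ρ = (I₂/2) ⊗ |ψ₀₀⟩⟨ψ₀₀| be the 3-qubit state where I₂ is the 2×2 identity and |ψ₀₀⟩ = (|00⟩ + |11⟩)/√2. Then: (i) taking A₀ = A₁ = I₂ (the rank-two projective observable with fixed outcome) and B₀ = X, B₁ = Y viewed appropriately — concretely, there exist 2×2 Hermitian observables A₀ = A₁ = I₂ and rank-one projective observables B_y = b_y·σ⃗, C_z = c_z·σ⃗ with unit vectors b_y, c_z ∈ ℝ³ such that Tr[M₃ ρ] = 2√2; (ii) for every choice of unit vectors a₀, a₁, b₀, b₁, c₀, c₁ ∈ ℝ³ defining rank-one projective observables A_x = a_x·σ⃗, B_y = b_y·σ⃗, C_z = c_z·σ⃗, one has Tr[M₃ ρ] = 0. -/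
open BigOperators Matrix Kronecker

/-- The tripartite MABK operator
`M₃ = A₀⊗B₀⊗C₁ + A₀⊗B₁⊗C₀ + A₁⊗B₀⊗C₀ − A₁⊗B₁⊗C₁` (Kronecker products, with the
first tensor factor the 2-dimensional one). -/
noncomputable def mabk3' (A₀ A₁ B₀ B₁ C₀ C₁ : Matrix (Fin 2) (Fin 2) ℂ) :
    Matrix (Fin 2 × Fin 2 × Fin 2) (Fin 2 × Fin 2 × Fin 2) ℂ :=
  A₀ ⊗ₖ (B₀ ⊗ₖ C₁) + A₀ ⊗ₖ (B₁ ⊗ₖ C₀) + A₁ ⊗ₖ (B₀ ⊗ₖ C₀) - A₁ ⊗ₖ (B₁ ⊗ₖ C₁)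

/-- The two-qubit Bell state `|ψ₀₀⟩ = (|00⟩ + |11⟩)/√2`. -/
noncomputable def bell : Fin 2 × Fin 2 → ℂ :=
  fun p => if p = (0, 0) ∨ p = (1, 1) then (((Real.sqrt 2)⁻¹ : ℝ) : ℂ) else 0

/-- The rank-one operator `|u⟩⟨v|` on two qubits. -/
noncomputable def outer2 (u v : Fin 2 × Fin 2 → ℂ) :
    Matrix (Fin 2 × Fin 2) (Fin 2 × Fin 2) ℂ :=
  fun r c => u r * (starRingEnd ℂ) (v c)

/-- The state `ρ = (I₂/2) ⊗ |ψ₀₀⟩⟨ψ₀₀|`. -/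
noncomputable def rhoMix : Matrix (Fin 2 × Fin 2 × Fin 2) (Fin 2 × Fin 2 × Fin 2) ℂ :=
  ((1 / 2 : ℂ) • (1 : Matrix (Fin 2) (Fin 2) ℂ)) ⊗ₖ outer2 bell bell

theorem trace_term_s18 (A B C : Matrix (Fin 2) (Fin 2) ℂ) :
    Matrix.trace ((A ⊗ₖ (B ⊗ₖ C)) * rhoMix) =
      (1 / 4 : ℂ) * (A 0 0 + A 1 1) *
        (B 0 0 * C 0 0 + B 0 1 * C 0 1 + B 1 0 * C 1 0 + B 1 1 * C 1 1) := by
  have hs : (((Real.sqrt 2 : ℝ) : ℂ))⁻¹ * (((Real.sqrt 2 : ℝ) : ℂ))⁻¹ = 1 / 2 := by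
    rw [← mul_inv, ← Complex.ofReal_mul, Real.mul_self_sqrt (by norm_num)]
    norm_num
  have h2 : Matrix.trace ((B ⊗ₖ C) * outer2 bell bell) =
      (1 / 2 : ℂ) *
        (B 0 0 * C 0 0 + B 0 1 * C 0 1 + B 1 0 * C 1 0 + B 1 1 * C 1 1) := by
    rw [← hs]
    simp [Matrix.trace, Matrix.mul_apply, Fintype.sum_prod_type, outer2, bell]
    ring
  rw [rhoMix, ← Matrix.mul_kronecker_mul, Matrix.trace_kronecker, h2]
  simp [Matrix.trace_fin_two]
  ring

theorem trace_mabk_s18 (A₀ A₁ B₀ B₁ C₀ C₁ : Matrix (Fin 2) (Fin 2) ℂ) :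
    Matrix.trace (mabk3' A₀ A₁ B₀ B₁ C₀ C₁ * rhoMix) =
      Matrix.trace ((A₀ ⊗ₖ (B₀ ⊗ₖ C₁)) * rhoMix) + Matrix.trace ((A₀ ⊗ₖ (B₁ ⊗ₖ C₀)) * rhoMix)
      + Matrix.trace ((A₁ ⊗ₖ (B₀ ⊗ₖ C₀)) * rhoMix)
      - Matrix.trace ((A₁ ⊗ₖ (B₁ ⊗ₖ C₁)) * rhoMix) := by
  rw [mabk3', Matrix.sub_mul, Matrix.add_mul, Matrix.add_mul, Matrix.trace_sub,
    Matrix.trace_add, Matrix.trace_add]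

theorem obs_traceless (a : Fin 3 → ℝ) : obs a 0 0 + obs a 1 1 = 0 := by
  simp [obs, Fin.sum_univ_three, pauli]

/-- for the 3-qubit state `ρ = (I₂/2) ⊗ |ψ₀₀⟩⟨ψ₀₀|`:
(i) with the rank-two projective observables `A₀ = A₁ = I₂` (fixed outcome) and
suitable rank-one projective observables `B_y = b_y·σ⃗`, `C_z = c_z·σ⃗` (unit vectors),
the MABK value `Tr[M₃ρ] = 2√2` is achieved; (ii) for every choice of unit vectors
`a₀,a₁,b₀,b₁,c₀,c₁ ∈ ℝ³` defining rank-one projective observables one gets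
`Tr[M₃ρ] = 0`. -/
theorem stmt18 :
    (∃ b₀ b₁ c₀ c₁ : Fin 3 → ℝ,
      (∑ t, b₀ t ^ 2 = 1) ∧ (∑ t, b₁ t ^ 2 = 1) ∧
      (∑ t, c₀ t ^ 2 = 1) ∧ (∑ t, c₁ t ^ 2 = 1) ∧
      (Matrix.trace
        (mabk3' 1 1 (obs b₀) (obs b₁) (obs c₀) (obs c₁) * rhoMix)).re
        = 2 * Real.sqrt 2) ∧
    (∀ a₀ a₁ b₀ b₁ c₀ c₁ : Fin 3 → ℝ,
      (∑ t, a₀ t ^ 2 = 1) → (∑ t, a₁ t ^ 2 = 1) →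
      (∑ t, b₀ t ^ 2 = 1) → (∑ t, b₁ t ^ 2 = 1) →
      (∑ t, c₀ t ^ 2 = 1) → (∑ t, c₁ t ^ 2 = 1) →
      (Matrix.trace
        (mabk3' (obs a₀) (obs a₁) (obs b₀) (obs b₁) (obs c₀) (obs c₁) * rhoMix)).re
        = 0) := by
  have hsq : (Real.sqrt 2)⁻¹ ^ 2 = 1 / 2 := by
    rw [inv_pow, Real.sq_sqrt (by norm_num)]
    norm_num
  refine ⟨⟨![1, 0, 0], ![0, 0, 1], ![(Real.sqrt 2)⁻¹, 0, (Real.sqrt 2)⁻¹],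
    ![(Real.sqrt 2)⁻¹, 0, -(Real.sqrt 2)⁻¹], ?_, ?_, ?_, ?_, ?_⟩, ?_⟩
  · simp [Fin.sum_univ_three]
  · simp [Fin.sum_univ_three]
  · simp only [Fin.sum_univ_three, Matrix.cons_val]
    linarith
  · simp only [Fin.sum_univ_three, Matrix.cons_val, neg_sq]
    linarith
  · have key : Matrix.trace (mabk3' 1 1 (obs ![1, 0, 0]) (obs ![0, 0, 1])
        (obs ![(Real.sqrt 2)⁻¹, 0, (Real.sqrt 2)⁻¹])
        (obs ![(Real.sqrt 2)⁻¹, 0, -(Real.sqrt 2)⁻¹]) * rhoMix)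
        = ((4 * (Real.sqrt 2)⁻¹ : ℝ) : ℂ) := by
      rw [trace_mabk_s18]
      simp only [trace_term_s18]
      simp [obs, Fin.sum_univ_three, pauli]
      ring
    rw [key, Complex.ofReal_re]
    have h0 : Real.sqrt 2 ≠ 0 := by positivity
    field_simp
    rw [Real.sq_sqrt (by norm_num)]
    norm_num
  · intro a₀ a₁ b₀ b₁ c₀ c₁ _ _ _ _ _ _
    rw [trace_mabk_s18]
    simp only [trace_term_s18, obs_traceless]
    simp
end

section
/- For j, k, a, b, c ∈ {0,1} and angles φ_A, φ_B, φ_C ∈ ℝ, define the product state |a,b,c⟩ = |a⟩_A ⊗ |b⟩_B ⊗ |c⟩_C ∈ ℂ⁸ with |a⟩_A = (|0⟩ + (−1)^a e^{iφ_A}|1⟩)/√2, |b⟩_B = (|0⟩ + (−1)^b e^{iφ_B}|1⟩)/√2, |c⟩_C = (|0⟩ + (−1)^c e^{iφ_C}|1⟩)/√2, and the GHZ-basis states |ψ_{i,j,k}⟩ = (|0,j,k⟩ + (−1)^i |1,j̄,k̄⟩)/√2. Then the complex number ⟨ψ_{0,j,k}| (|a,b,c⟩⟨a,b,c|) |ψ_{1,j,k}⟩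 equals i · 2(−1)^{a+b+c} · Im[ e^{iφ_A} · e^{iφ_B(−1)^j} · e^{iφ_C(−1)^k} ] / 16; in particular it is purely imaginary (its real part is zero) for all choices of j, k, a, b, c and the angles. -/
open BigOperators

/-- The single-qubit state `(|0⟩ + (−1)^x e^{iφ}|1⟩)/√2`. -/
noncomputable def qstate (x : Fin 2) (φ : ℝ) : Fin 2 → ℂ :=
  fun t => if t = 0 then (((Real.sqrt 2)⁻¹ : ℝ) : ℂ)
    else (-1 : ℂ) ^ (x : ℕ) * Complex.exp (Complex.I * (φ : ℂ))
      * (((Real.sqrt 2)⁻¹ : ℝ) : ℂ)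

/-- The product state `|a,b,c⟩ = |a⟩_A ⊗ |b⟩_B ⊗ |c⟩_C`. -/
noncomputable def prodState (a b c : Fin 2) (φA φB φC : ℝ) :
    ((Fin 2 × Fin 2) × Fin 2) → ℂ :=
  fun v => qstate a φA v.1.1 * qstate b φB v.1.2 * qstate c φC v.2

/-- The double sum collapses to the two basis vectors supporting the GHZ states. -/
lemma ghz_sum_collapse (j k : Fin 2) (p : ((Fin 2 × Fin 2) × Fin 2) → ℂ) :
    (∑ r, ∑ s, (starRingEnd ℂ) (ghz 0 j k r) * outer p p r s * ghz 1 j k s)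
      = (p ((0, j), k) + p ((1, 1 - j), 1 - k))
        * (starRingEnd ℂ) (p ((0, j), k) - p ((1, 1 - j), 1 - k)) / 2 := by
  have hs : (((Real.sqrt 2)⁻¹ : ℝ) : ℂ) * (((Real.sqrt 2)⁻¹ : ℝ) : ℂ) = 1 / 2 := by
    rw [← Complex.ofReal_mul, ← mul_inv, Real.mul_self_sqrt (by norm_num)]
    norm_num
  have h1 : ∑ r, (starRingEnd ℂ) (ghz 0 j k r) * p r
      = (((Real.sqrt 2)⁻¹ : ℝ) : ℂ) * (p ((0, j), k) + p ((1, 1 - j), 1 - k)) := by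
    simp only [ghz, map_add, apply_ite (starRingEnd ℂ), Complex.conj_ofReal, map_zero, add_mul,
      ite_mul, zero_mul, Finset.sum_add_distrib, Finset.sum_ite_eq', Finset.sum_ite_eq,
      Finset.mem_univ, if_true, map_mul, map_pow]
    simp
    ring
  have h2 : ∑ s, (starRingEnd ℂ) (p s) * ghz 1 j k s
      = (((Real.sqrt 2)⁻¹ : ℝ) : ℂ)
        * (starRingEnd ℂ) (p ((0, j), k) - p ((1, 1 - j), 1 - k)) := by
    simp only [ghz, mul_add, mul_ite, mul_zero, Finset.sum_add_distrib, Finset.sum_ite_eq',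
      Finset.mem_univ, if_true, map_sub]
    simp
    ring
  have h3 : (∑ r, ∑ s, (starRingEnd ℂ) (ghz 0 j k r) * outer p p r s * ghz 1 j k s)
      = (∑ r, (starRingEnd ℂ) (ghz 0 j k r) * p r)
        * ∑ s, (starRingEnd ℂ) (p s) * ghz 1 j k s := by
    rw [Finset.sum_mul_sum]
    refine Finset.sum_congr rfl fun r _ => Finset.sum_congr rfl fun s _ => ?_
    simp only [outer]
    ring
  rw [h3, h1, h2]
  linear_combination ((p ((0, j), k) + p ((1, 1 - j), 1 - k))
        * (starRingEnd ℂ) (p ((0, j), k) - p ((1, 1 - j), 1 - k))) * hs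

lemma ghz_I_mul_im (z : ℂ) : Complex.I * (z.im : ℂ) = (z - (starRingEnd ℂ) z) / 2 := by
  rw [Complex.sub_conj]
  push_cast
  ring

lemma ghz_conj_phase (φ : ℝ) : (starRingEnd ℂ) (Complex.exp (Complex.I * (φ : ℂ)))
    = Complex.exp (-(Complex.I * (φ : ℂ))) := by
  rw [← Complex.exp_conj]
  simp

lemma ghz_main_eq (j k a b c : Fin 2) (φA φB φC : ℝ) :
    (∑ r, ∑ s, (starRingEnd ℂ) (ghz 0 j k r)
        * outer (prodState a b c φA φB φC) (prodState a b c φA φB φC) r s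
        * ghz 1 j k s)
      = Complex.I * (((2 * (-1 : ℝ) ^ ((a : ℕ) + (b : ℕ) + (c : ℕ))
          * (Complex.exp (Complex.I * (φA : ℂ))
            * Complex.exp (Complex.I * (φB : ℂ) * (-1 : ℂ) ^ (j : ℕ))
            * Complex.exp (Complex.I * (φC : ℂ) * (-1 : ℂ) ^ (k : ℕ))).im / 16 : ℝ)
          : ℂ)) := by
  rw [ghz_sum_collapse]
  generalize hz : (Complex.exp (Complex.I * (φA : ℂ))
            * Complex.exp (Complex.I * (φB : ℂ) * (-1 : ℂ) ^ (j : ℕ))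
            * Complex.exp (Complex.I * (φC : ℂ) * (-1 : ℂ) ^ (k : ℕ))) = z
  have hR : Complex.I * (((2 * (-1 : ℝ) ^ ((a : ℕ) + (b : ℕ) + (c : ℕ)) * z.im / 16 : ℝ)) : ℂ)
      = (-1 : ℂ) ^ (a : ℕ) * (-1 : ℂ) ^ (b : ℕ) * (-1 : ℂ) ^ (c : ℕ)
        * (z - (starRingEnd ℂ) z) / 16 := by
    push_cast
    rw [pow_add, pow_add]
    linear_combination ((-1 : ℂ) ^ (a : ℕ) * (-1 : ℂ) ^ (b : ℕ) * (-1 : ℂ) ^ (c : ℕ) / 8)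
      * ghz_I_mul_im z
  rw [hR, ← hz]
  have hs : (((Real.sqrt 2)⁻¹ : ℝ) : ℂ) ^ 2 = 1 / 2 := by
    rw [← Complex.ofReal_pow, inv_pow, Real.sq_sqrt (by norm_num)]
    norm_num
  have hs6 : (((Real.sqrt 2)⁻¹ : ℝ) : ℂ) ^ 6 = 1 / 8 := by
    have h := pow_mul (((Real.sqrt 2)⁻¹ : ℝ) : ℂ) 2 3
    rw [hs] at h
    norm_num at h ⊢
    exact h
  have hsg : ∀ x : Fin 2, ((-1 : ℂ) ^ (x : ℕ)) ^ 2 = 1 := by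
    intro x
    rw [← pow_mul, mul_comm, pow_mul]
    simp
  have hE : ∀ φ : ℝ, Complex.exp (Complex.I * (φ : ℂ)) * Complex.exp (-(Complex.I * (φ : ℂ)))
      = 1 := by
    intro φ
    rw [← Complex.exp_add]
    simp
  have hcE : ∀ φ : ℝ, (starRingEnd ℂ) (Complex.exp (-(Complex.I * (φ : ℂ))))
      = Complex.exp (Complex.I * (φ : ℂ)) := by
    intro φ
    rw [← ghz_conj_phase, Complex.conj_conj]
  have ha := hsg a
  have hb := hsg b
  have hc := hsg c
  have hA := hE φA
  have hB := hE φB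
  have hC := hE φC
  fin_cases j <;> fin_cases k <;>
  · simp only [prodState, qstate, Fin.zero_eta, Fin.mk_one, Fin.isValue, sub_zero, sub_self,
      one_ne_zero, if_true, if_false, map_mul, map_sub, map_pow, map_neg, map_one,
      Complex.conj_ofReal, ghz_conj_phase, hcE, Fin.val_zero, Fin.val_one, pow_zero, pow_one, mul_one,
      mul_neg]
    generalize (((Real.sqrt 2)⁻¹ : ℝ) : ℂ) = s at *
    generalize (-1 : ℂ) ^ (a : ℕ) = x at *
    generalize (-1 : ℂ) ^ (b : ℕ) = y at *
    generalize (-1 : ℂ) ^ (c : ℕ) = w at *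
    generalize Complex.exp (Complex.I * (φA : ℂ)) = A at *
    generalize Complex.exp (Complex.I * (φB : ℂ)) = B at *
    generalize Complex.exp (Complex.I * (φC : ℂ)) = C at *
    generalize Complex.exp (-(Complex.I * (φA : ℂ))) = Aconj at *
    generalize Complex.exp (-(Complex.I * (φB : ℂ))) = Bconj at *
    generalize Complex.exp (-(Complex.I * (φC : ℂ))) = Cconj at *
    clear hR hz hcE hE hsg
    grind

/-- the matrix element `⟨ψ_{0,j,k}| (|a,b,c⟩⟨a,b,c|) |ψ_{1,j,k}⟩` equals
`i · 2(−1)^{a+b+c} · Im[e^{iφ_A} e^{iφ_B(−1)^j} e^{iφ_C(−1)^k}] / 16`; in particular it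
is purely imaginary (its real part vanishes) for all bits `j,k,a,b,c` and angles. -/
theorem stmt19 (j k a b c : Fin 2) (φA φB φC : ℝ) :
    (∑ r, ∑ s, (starRingEnd ℂ) (ghz 0 j k r)
        * outer (prodState a b c φA φB φC) (prodState a b c φA φB φC) r s
        * ghz 1 j k s)
      = Complex.I * (((2 * (-1 : ℝ) ^ ((a : ℕ) + (b : ℕ) + (c : ℕ))
          * (Complex.exp (Complex.I * (φA : ℂ))
            * Complex.exp (Complex.I * (φB : ℂ) * (-1 : ℂ) ^ (j : ℕ))
            * Complex.exp (Complex.I * (φC : ℂ) * (-1 : ℂ) ^ (k : ℕ))).im / 16 : ℝ)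
          : ℂ)) ∧
    (∑ r, ∑ s, (starRingEnd ℂ) (ghz 0 j k r)
        * outer (prodState a b c φA φB φC) (prodState a b c φA φB φC) r s
        * ghz 1 j k s).re = 0 := by
  have h := ghz_main_eq j k a b c φA φB φC
  refine ⟨h, ?_⟩
  rw [h, Complex.I_mul_re, Complex.ofReal_im, neg_zero]
end
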